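/- Let u⃗ ∈ S_ind(n,s) and let (Pu⃗)_i(ζ) = ∫_0^∞ ( u_i(iy)(∂_x R_ζ^s)(iy) − R_ζ^s(iy)(∂_x u_i)(iy) ) dy for ζ > 0. Then each component satisfies the growth conditions (Pu⃗)_i(ζ) = O(ζ^{max(0, −2 Re s)}) as ζ ↓ 0 and (Pu⃗)_i(ζ) = O(ζ^{min(0, −2 Re s)}) as ζ → ∞. -/

import Mathlib

noncomputable section

open Complex MeasureTheory

/- ## Farey machinery -/

/-- The Farey sequence of level `n`, as a subset of the extended reals;
`⊥ = -∞ = -1/0`, `⊤ = ∞ = 1/0`. -/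
def fareySet (n : ℕ) : Set EReal :=
  {⊥, ⊤, 0} ∪ {x : EReal | ∃ q : ℚ, x = ((q : ℝ) : EReal) ∧ q.num.natAbs ≤ n ∧ q.den ≤ n}

/-- The level of an element of `ℚ ∪ {±∞}`. -/
def flev (x : EReal) : ℕ := sInf {n : ℕ | x ∈ fareySet n}

/-- The left neighbor map: the largest element of `F_{lev x}` strictly below `x`. -/
def fLN (x : EReal) : EReal := sSup {r : EReal | r ∈ fareySet (flev x) ∧ r < x}

/-- The length `L` of the left neighbor sequence: the least `L` with `LN^L q = -∞`. -/
def fL (x : EReal) : ℕ := sInf {L : ℕ | fLN^[L] x = ⊥}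

/-- The members `y_l = LN^{L-l}(q)` of the left neighbor sequence `LNS(q)`. -/
def yseq (q : ℚ) (l : ℕ) : EReal := fLN^[fL ((q : ℝ) : EReal) - l] ((q : ℝ) : EReal)

/-- The fraction `a/c` as an element of `ℚ ∪ {±∞}` (with `1/0 = ∞`, `-1/0 = -∞`). -/
def efrac (a c : ℤ) : EReal :=
  if c = 0 then (if 0 < a then ⊤ else ⊥) else ((((a : ℚ) / (c : ℚ) : ℚ) : ℝ) : EReal)

open Classical in
/-- The numerator of an element of `ℚ ∪ {±∞}` in lowest terms (`-∞ = -1/0`, `∞ = 1/0`). -/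
def enum (x : EReal) : ℤ :=
  if x = ⊥ then -1
  else if x = ⊤ then 1
  else if h : ∃ q : ℚ, x = ((q : ℝ) : EReal) then h.choose.num else 0

open Classical in
/-- The (nonnegative) denominator of an element of `ℚ ∪ {±∞}` in lowest terms. -/
def eden (x : EReal) : ℤ :=
  if x = ⊥ then 0
  else if x = ⊤ then 0
  else if h : ∃ q : ℚ, x = ((q : ℝ) : EReal) then (h.choose.den : ℤ) else 0

/-- The matrix `m_l = [[b_l, -a_l], [b_{l-1}, -a_{l-1}]]` from `M(q) = Σ_l m_l`. -/
def mMat (q : ℚ) (l : ℕ) : Matrix (Fin 2) (Fin 2) ℤ :=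
  !![eden (yseq q l), -enum (yseq q l); eden (yseq q (l - 1)), -enum (yseq q (l - 1))]

/- ## Matrix groups -/

abbrev SL2 := Matrix.SpecialLinearGroup (Fin 2) ℤ

/-- The Hecke congruence subgroup `Γ₀(n)` inside `SL₂(ℤ)`. -/
def Gam0 (n : ℕ) : Set SL2 := {g : SL2 | (n : ℤ) ∣ (g : Matrix (Fin 2) (Fin 2) ℤ) 1 0}

/-- `X_m`: upper triangular integer matrices `[[a,b],[0,d]]` with `ad = m`, `d > b ≥ 0`. -/
def Xset (m : ℕ) : Set (Matrix (Fin 2) (Fin 2) ℤ) :=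
  {A | A 1 0 = 0 ∧ A 0 0 * A 1 1 = (m : ℤ) ∧ 0 ≤ A 0 1 ∧ A 0 1 < A 1 1}

/-- `X_m` as a finite set. -/
def XF (m : ℕ) : Finset (Matrix (Fin 2) (Fin 2) ℤ) :=
  ((m.divisors ×ˢ Finset.range m).filter fun p => p.2 < p.1).image
    fun p => !![((m / p.1 : ℕ) : ℤ), (p.2 : ℤ); 0, (p.1 : ℤ)]

/-- Möbius action of an integer matrix on (a suitable part of) `ℂ`. -/
def moeb (g : Matrix (Fin 2) (Fin 2) ℤ) (z : ℂ) : ℂ :=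
  ((g 0 0 : ℂ) * z + (g 0 1 : ℂ)) / ((g 1 0 : ℂ) * z + (g 1 1 : ℂ))

/-- `α : Fin μ → SL₂(ℤ)` is a full set of representatives of the right cosets
`Γ₀(n) \ SL₂(ℤ)`. -/
def IsCosetReps (n : ℕ) {μ : ℕ} (α : Fin μ → SL2) : Prop :=
  (∀ g : SL2, ∃ j : Fin μ, ∃ γ ∈ Gam0 n, g = γ * α j) ∧
  (∀ j k : Fin μ, (∃ γ ∈ Gam0 n, α j = γ * α k) → j = k)

open Classical in
/-- The representation of `SL₂(ℤ)` induced from the trivial representation of `Γ₀(n)`: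
a permutation matrix realization of the right regular representation. -/
def rho (n : ℕ) {μ : ℕ} (α : Fin μ → SL2) (g : SL2) : Matrix (Fin μ) (Fin μ) ℂ :=
  fun i j => if α i * g * (α j)⁻¹ ∈ Gam0 n then 1 else 0

/- ## Analysis -/

/-- Partial derivative in the `x` (real) direction. -/
def pdx (f : ℂ → ℂ) (z : ℂ) : ℂ := deriv (fun x : ℝ => f (x + z.im * Complex.I)) z.re

/-- Partial derivative in the `y` (imaginary) direction. -/
def pdy (f : ℂ → ℂ) (z : ℂ) : ℂ := deriv (fun y : ℝ => f (z.re + y * Complex.I)) z.im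

/-- The hyperbolic Laplacian `Δ = -y²(∂_x² + ∂_y²)`. -/
def laplace (f : ℂ → ℂ) (z : ℂ) : ℂ := -(z.im : ℂ) ^ 2 * (pdx (pdx f) z + pdy (pdy f) z)

/-- `R_ζ(z) = Im z / |z - ζ|²`. -/
def Rfun (ζ : ℝ) (z : ℂ) : ℝ := z.im / ((z.re - ζ) ^ 2 + z.im ^ 2)

/-- `R_ζ^s(z)`, using the principal branch on the positive real `R_ζ(z)`. -/
def Rpow (s : ℂ) (ζ : ℝ) (z : ℂ) : ℂ := ((Rfun ζ z : ℝ) : ℂ) ^ s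

/-- A Maass cusp form for `Γ₀(n)` with spectral parameter `s`. -/
structure IsCuspForm (n : ℕ) (s : ℂ) (u : ℂ → ℂ) : Prop where
  analytic : AnalyticOnNhd ℝ u {z : ℂ | 0 < z.im}
  invar : ∀ g ∈ Gam0 n, ∀ z : ℂ, 0 < z.im → u (moeb g z) = u z
  eigen : ∀ z : ℂ, 0 < z.im → laplace u z = s * (1 - s) * u z
  decay : ∀ g : SL2, ∀ C : ℝ, ∃ K T : ℝ, ∀ z : ℂ, 0 < z.im → T ≤ z.im →
    ‖u (moeb g z)‖ ≤ K * z.im ^ C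

/-- A vector valued cusp form for `Γ₀(n)` with spectral parameter `s`. -/
structure IsVVCuspForm (n : ℕ) {μ : ℕ} (α : Fin μ → SL2) (s : ℂ) (U : ℂ → Fin μ → ℂ) :
    Prop where
  analytic : ∀ j, AnalyticOnNhd ℝ (fun z => U z j) {z : ℂ | 0 < z.im}
  equivar : ∀ g : SL2, ∀ z : ℂ, 0 < z.im → ∀ j,
    U (moeb g z) j = ∑ k, rho n α g j k * U z k
  eigen : ∀ j, ∀ z : ℂ, 0 < z.im → laplace (fun w => U w j) z = s * (1 - s) * U z j
  decay : ∀ j, ∀ C : ℝ, ∃ K T : ℝ, ∀ z : ℂ, 0 < z.im → T ≤ z.im → ‖U z j‖ ≤ K * z.im ^ C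

/-- The map `Π` from cusp forms to vector valued cusp forms. -/
def PiMap {μ : ℕ} (α : Fin μ → SL2) (u : ℂ → ℂ) : ℂ → Fin μ → ℂ :=
  fun z j => u (moeb (α j : Matrix (Fin 2) (Fin 2) ℤ) z)

/-- The integral transform `P`, componentwise:
`(Pu)(ζ) = ∫_0^∞ (u(iy) ∂_x R_ζ^s(iy) - R_ζ^s(iy) ∂_x u(iy)) dy`. -/
def Ptrans (s : ℂ) (v : ℂ → ℂ) (ζ : ℝ) : ℂ :=
  ∫ y in Set.Ioi (0 : ℝ),
    (v (y * Complex.I) * pdx (Rpow s ζ) (y * Complex.I)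
      - Rpow s ζ (y * Complex.I) * pdx v (y * Complex.I))

def Tmat : SL2 := ⟨!![1, 1; 0, 1], by norm_num [Matrix.det_fin_two_of]⟩

def Tmat' : SL2 := ⟨!![1, 0; 1, 1], by norm_num [Matrix.det_fin_two_of]⟩

/-- A (vector valued) period function for `Γ₀(n)` with spectral parameter `s`. -/
structure IsPeriodFn (n : ℕ) {μ : ℕ} (α : Fin μ → SL2) (s : ℂ) (ψ : ℝ → Fin μ → ℂ) :
    Prop where
  analytic : ∀ i, AnalyticOnNhd ℝ (fun ζ => ψ ζ i) (Set.Ioi 0)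
  threeterm : ∀ ζ : ℝ, 0 < ζ → ∀ i,
    ψ ζ i = ∑ k, rho n α Tmat⁻¹ i k * ψ (ζ + 1) k
      + ((ζ + 1 : ℝ) : ℂ) ^ (-(2 * s)) * ∑ k, rho n α Tmat'⁻¹ i k * ψ (ζ / (ζ + 1)) k
  grow0 : ∀ i, ∃ K ε : ℝ, 0 < ε ∧ ∀ ζ : ℝ, 0 < ζ → ζ < ε →
    ‖ψ ζ i‖ ≤ K * ζ ^ (max 0 (-2 * s.re))
  growInf : ∀ i, ∃ K T : ℝ, ∀ ζ : ℝ, T ≤ ζ → 0 < ζ →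
    ‖ψ ζ i‖ ≤ K * ζ ^ (min 0 (-2 * s.re))



/-! ### Partial derivatives of real-analytic functions on the upper half-plane -/

lemma isOpen_im_pos : IsOpen {z : ℂ | 0 < z.im} :=
  isOpen_lt continuous_const Complex.continuous_im

lemma hasDerivAt_horizontal (x y : ℝ) :
    HasDerivAt (fun t : ℝ => (t : ℂ) + y * Complex.I) 1 x := by
  simpa using (Complex.ofRealCLM.hasDerivAt (x := x)).add_const ((y : ℂ) * Complex.I)

lemma hasDerivAt_vertical (x y : ℝ) :
    HasDerivAt (fun t : ℝ => (x : ℂ) + t * Complex.I) Complex.I y := by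
  simpa using ((Complex.ofRealCLM.hasDerivAt (x := y)).mul_const Complex.I).const_add (x : ℂ)

lemma hasDerivAt_comp_horizontal {f : ℂ → ℂ} {z : ℂ} (hf : DifferentiableAt ℝ f z) :
    HasDerivAt (fun t : ℝ => f (t + z.im * Complex.I)) (fderiv ℝ f z 1) z.re := by
  have h := hasDerivAt_horizontal z.re z.im
  have hz : (z.re : ℂ) + z.im * Complex.I = z := Complex.re_add_im z
  exact HasFDerivAt.comp_hasDerivAt z.re (by rw [hz]; exact hf.hasFDerivAt) h

lemma hasDerivAt_comp_vertical {f : ℂ → ℂ} {z : ℂ} (hf : DifferentiableAt ℝ f z) :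
    HasDerivAt (fun t : ℝ => f (z.re + t * Complex.I)) (fderiv ℝ f z Complex.I) z.im := by
  have h := hasDerivAt_vertical z.re z.im
  have hz : (z.re : ℂ) + z.im * Complex.I = z := Complex.re_add_im z
  exact HasFDerivAt.comp_hasDerivAt z.im (by rw [hz]; exact hf.hasFDerivAt) h

lemma pdx_eq_fderiv {f : ℂ → ℂ} {z : ℂ} (hf : DifferentiableAt ℝ f z) :
    pdx f z = fderiv ℝ f z 1 :=
  (hasDerivAt_comp_horizontal hf).deriv

lemma pdy_eq_fderiv {f : ℂ → ℂ} {z : ℂ} (hf : DifferentiableAt ℝ f z) :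
    pdy f z = fderiv ℝ f z Complex.I :=
  (hasDerivAt_comp_vertical hf).deriv

lemma differentiableAt_of_analyticOnNhd {f : ℂ → ℂ}
    (hf : AnalyticOnNhd ℝ f {z : ℂ | 0 < z.im}) {z : ℂ} (hz : 0 < z.im) :
    DifferentiableAt ℝ f z :=
  (hf z hz).differentiableAt

lemma hasDerivAt_pdx {f : ℂ → ℂ} (hf : AnalyticOnNhd ℝ f {z : ℂ | 0 < z.im})
    (x : ℝ) {y : ℝ} (hy : 0 < y) :
    HasDerivAt (fun t : ℝ => f (t + y * Complex.I)) (pdx f (x + y * Complex.I)) x := by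
  have hd : DifferentiableAt ℝ f (x + y * Complex.I) :=
    differentiableAt_of_analyticOnNhd hf (by simpa using hy)
  simpa [pdx_eq_fderiv hd] using hasDerivAt_comp_horizontal hd

lemma hasDerivAt_pdy {f : ℂ → ℂ} (hf : AnalyticOnNhd ℝ f {z : ℂ | 0 < z.im})
    (x : ℝ) {y : ℝ} (hy : 0 < y) :
    HasDerivAt (fun t : ℝ => f (x + t * Complex.I)) (pdy f (x + y * Complex.I)) y := by
  have hd : DifferentiableAt ℝ f (x + y * Complex.I) :=
    differentiableAt_of_analyticOnNhd hf (by simpa using hy)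
  simpa [pdy_eq_fderiv hd] using hasDerivAt_comp_vertical hd

lemma analyticOnNhd_fderiv_apply {f : ℂ → ℂ} (hf : AnalyticOnNhd ℝ f {z : ℂ | 0 < z.im})
    (v : ℂ) : AnalyticOnNhd ℝ (fun z => fderiv ℝ f z v) {z : ℂ | 0 < z.im} :=
  (ContinuousLinearMap.apply ℝ ℂ v).comp_analyticOnNhd hf.fderiv

lemma AnalyticOnNhd.pdx {f : ℂ → ℂ} (hf : AnalyticOnNhd ℝ f {z : ℂ | 0 < z.im}) :
    AnalyticOnNhd ℝ (pdx f) {z : ℂ | 0 < z.im} :=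
  (analyticOnNhd_fderiv_apply hf 1).congr isOpen_im_pos fun _ hz =>
    (pdx_eq_fderiv (differentiableAt_of_analyticOnNhd hf hz)).symm

lemma AnalyticOnNhd.pdy {f : ℂ → ℂ} (hf : AnalyticOnNhd ℝ f {z : ℂ | 0 < z.im}) :
    AnalyticOnNhd ℝ (pdy f) {z : ℂ | 0 < z.im} :=
  (analyticOnNhd_fderiv_apply hf Complex.I).congr isOpen_im_pos fun _ hz =>
    (pdy_eq_fderiv (differentiableAt_of_analyticOnNhd hf hz)).symm

lemma pdx_congr {f g : ℂ → ℂ} (h : ∀ z : ℂ, 0 < z.im → f z = g z) {z : ℂ} (hz : 0 < z.im) :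
    pdx f z = pdx g z := by
  unfold pdx
  congr 1
  ext t
  exact h _ (by simpa using hz)

lemma pdy_congr {f g : ℂ → ℂ} (h : ∀ z : ℂ, 0 < z.im → f z = g z) {z : ℂ} (hz : 0 < z.im) :
    pdy f z = pdy g z := by
  refine Filter.EventuallyEq.deriv_eq ?_
  filter_upwards [lt_mem_nhds hz] with t ht
  exact h _ (by simpa using ht)

lemma fderiv_fderiv_apply {f : ℂ → ℂ} (hf : AnalyticOnNhd ℝ f {z : ℂ | 0 < z.im})
    {z : ℂ} (hz : 0 < z.im) (v w : ℂ) :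
    fderiv ℝ (fun z' => fderiv ℝ f z' v) z w = fderiv ℝ (fderiv ℝ f) z w v := by
  have hd : DifferentiableAt ℝ (fderiv ℝ f) z := (hf.fderiv z hz).differentiableAt
  rw [fderiv_clm_apply hd (differentiableAt_const v)]
  simp

lemma pdx_pdy_comm {f : ℂ → ℂ} (hf : AnalyticOnNhd ℝ f {z : ℂ | 0 < z.im})
    {z : ℂ} (hz : 0 < z.im) : pdx (pdy f) z = pdy (pdx f) z := by
  have h1 : pdx (pdy f) z = pdx (fun z' => fderiv ℝ f z' Complex.I) z :=
    pdx_congr (fun w hw => pdy_eq_fderiv (differentiableAt_of_analyticOnNhd hf hw)) hz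
  have h2 : pdy (pdx f) z = pdy (fun z' => fderiv ℝ f z' 1) z :=
    pdy_congr (fun w hw => pdx_eq_fderiv (differentiableAt_of_analyticOnNhd hf hw)) hz
  rw [h1, h2,
    pdx_eq_fderiv (differentiableAt_of_analyticOnNhd (analyticOnNhd_fderiv_apply hf _) hz),
    pdy_eq_fderiv (differentiableAt_of_analyticOnNhd (analyticOnNhd_fderiv_apply hf _) hz),
    fderiv_fderiv_apply hf hz, fderiv_fderiv_apply hf hz]
  exact ((hf z hz).contDiffAt (n := 2)).isSymmSndFDerivAt (by simp) _ _

/-! ### Eigenfunctions of the Laplacian -/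

/-- Euclidean form of the eigenvalue equation. -/
lemma euclidean_eigen {u : ℂ → ℂ} {l : ℂ} (he : ∀ z : ℂ, 0 < z.im → laplace u z = l * u z)
    {z : ℂ} (hz : 0 < z.im) :
    pdx (pdx u) z + pdy (pdy u) z = -(l / (z.im : ℂ) ^ 2) * u z := by
  have h := he z hz
  have hy : (z.im : ℂ) ≠ 0 := by exact_mod_cast hz.ne'
  unfold laplace at h
  field_simp
  linear_combination -h

lemma euclidean_eigen_pdx {u : ℂ → ℂ} {l : ℂ} (hu : AnalyticOnNhd ℝ u {z : ℂ | 0 < z.im})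
    (he : ∀ z : ℂ, 0 < z.im → laplace u z = l * u z) {z : ℂ} (hz : 0 < z.im) :
    pdx (pdx (pdx u)) z + pdy (pdy (pdx u)) z = -(l / (z.im : ℂ) ^ 2) * pdx u z := by
  have hc : pdy (pdy (pdx u)) z = pdx (pdy (pdy u)) z := by
    rw [pdx_pdy_comm hu.pdy hz]
    exact pdy_congr (fun w hw => (pdx_pdy_comm hu hw).symm) hz
  have h1 : HasDerivAt (fun t : ℝ => pdx (pdx u) (t + z.im * Complex.I)
      + pdy (pdy u) (t + z.im * Complex.I))
      (pdx (pdx (pdx u)) z + pdx (pdy (pdy u)) z) z.re := by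
    simpa using (hasDerivAt_pdx hu.pdx.pdx z.re hz).fun_add (hasDerivAt_pdx hu.pdy.pdy z.re hz)
  have h2 : HasDerivAt (fun t : ℝ => -(l / (z.im : ℂ) ^ 2) * u (t + z.im * Complex.I))
      (-(l / (z.im : ℂ) ^ 2) * pdx u z) z.re := by
    simpa using (hasDerivAt_pdx hu z.re hz).const_mul (-(l / (z.im : ℂ) ^ 2))
  rw [hc]
  refine h1.unique (h2.congr_of_eventuallyEq (Filter.Eventually.of_forall fun t => ?_))
  simpa using euclidean_eigen he (z := (t : ℂ) + z.im * Complex.I) (by simpa using hz)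

lemma euclidean_eigen_pdy {u : ℂ → ℂ} {l : ℂ} (hu : AnalyticOnNhd ℝ u {z : ℂ | 0 < z.im})
    (he : ∀ z : ℂ, 0 < z.im → laplace u z = l * u z) {z : ℂ} (hz : 0 < z.im) :
    pdx (pdx (pdy u)) z + pdy (pdy (pdy u)) z
      = -(l / (z.im : ℂ) ^ 2) * pdy u z + 2 * l / (z.im : ℂ) ^ 3 * u z := by
  have hy : (z.im : ℂ) ≠ 0 := by exact_mod_cast hz.ne'
  have hc : pdx (pdx (pdy u)) z = pdy (pdx (pdx u)) z := by
    rw [← pdx_pdy_comm hu.pdx hz]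
    exact pdx_congr (fun w hw => pdx_pdy_comm hu hw) hz
  have h1 : HasDerivAt (fun t : ℝ => pdx (pdx u) (z.re + t * Complex.I)
      + pdy (pdy u) (z.re + t * Complex.I))
      (pdy (pdx (pdx u)) z + pdy (pdy (pdy u)) z) z.im := by
    simpa using (hasDerivAt_pdy hu.pdx.pdx z.re hz).fun_add (hasDerivAt_pdy hu.pdy.pdy z.re hz)
  have h3 : HasDerivAt (fun t : ℝ => -(l / (t : ℂ) ^ 2)) (2 * l / (z.im : ℂ) ^ 3) z.im := by
    have h := ((hasDerivAt_const (z.im : ℂ) l).div ((hasDerivAt_id (z.im : ℂ)).pow 2)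
      (pow_ne_zero 2 hy)).neg.comp_ofReal
    convert h using 1
    simp [Pi.pow_apply]
    field_simp
    simp
    ring
  have h2 := h3.mul (hasDerivAt_pdy hu z.re hz)
  rw [hc, h1.unique (h2.congr_of_eventuallyEq ?_)]
  · simp
    ring
  · filter_upwards [lt_mem_nhds hz] with t ht
    simpa using euclidean_eigen he (z := (z.re : ℂ) + t * Complex.I) (by simpa using ht)

/-! ### Interior gradient estimate -/

lemma second_deriv_nonpos_of_isLocalMax {F F' : ℝ → ℝ} {F'' x : ℝ}
    (hF : ∀ᶠ t in nhds x, HasDerivAt F (F' t) t) (hF' : HasDerivAt F' F'' x)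
    (hmax : IsLocalMax F x) : F'' ≤ 0 := by
  by_contra! hpos
  have hd : deriv F =ᶠ[nhds x] F' := hF.mono fun t ht => ht.deriv
  have hdd : deriv (deriv F) x = F'' := by rw [hd.deriv_eq, hF'.deriv]
  have hmin : IsLocalMin F x :=
    isLocalMin_of_deriv_deriv_pos (by rw [hdd]; exact hpos) hmax.deriv_eq_zero
      hF.self_of_nhds.continuousAt
  have hconst : F =ᶠ[nhds x] fun _ => F x := by
    filter_upwards [hmin, hmax] with t h1 h2 using le_antisymm h2 h1
  have h0 : deriv F =ᶠ[nhds x] fun _ => 0 := by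
    filter_upwards [hconst.eventuallyEq_nhds] with t ht
    rw [ht.deriv_eq, deriv_const]
  rw [h0.deriv_eq, deriv_const] at hdd
  exact hpos.ne hdd

/-- The second derivative test for the auxiliary function of Bernstein's method on a line. -/
lemma bernstein_line {g g' k k' : ℝ → ℂ} {g'' k'' : ℂ} {a b A B x : ℝ}
    (hg : ∀ᶠ t in nhds x, HasDerivAt g (g' t) t) (hg' : HasDerivAt g' g'' x)
    (hk : ∀ᶠ t in nhds x, HasDerivAt k (k' t) t) (hk' : HasDerivAt k' k'' x)
    (hmax : IsLocalMax (fun t => (a - (t - b) ^ 2) ^ 2 * ‖g t‖ ^ 2 + A * ‖k t‖ ^ 2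
      + B * (t - b) ^ 2) x) :
    (8 * (x - b) ^ 2 - 4 * (a - (x - b) ^ 2)) * ‖g x‖ ^ 2
      - 16 * (a - (x - b) ^ 2) * (x - b) * inner ℝ (g x) (g' x)
      + 2 * (a - (x - b) ^ 2) ^ 2 * (‖g' x‖ ^ 2 + inner ℝ (g x) g'')
      + 2 * A * (‖k' x‖ ^ 2 + inner ℝ (k x) k'') + 2 * B ≤ 0 := by
  have hq (t : ℝ) : HasDerivAt (fun t : ℝ => t - b) 1 t := (hasDerivAt_id t).sub_const b
  have hp (t : ℝ) : HasDerivAt (fun t : ℝ => a - (t - b) ^ 2) (-2 * (t - b)) t := by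
    refine (((hq t).fun_pow 2).const_sub a).congr_deriv ?_
    push_cast
    ring
  have h1 : ∀ᶠ t in nhds x, HasDerivAt (fun t => (a - (t - b) ^ 2) ^ 2 * ‖g t‖ ^ 2
      + A * ‖k t‖ ^ 2 + B * (t - b) ^ 2)
      (-4 * ((a - (t - b) ^ 2) * (t - b)) * ‖g t‖ ^ 2
        + 2 * ((a - (t - b) ^ 2) ^ 2 * inner ℝ (g t) (g' t))
        + 2 * A * inner ℝ (k t) (k' t) + 2 * B * (t - b)) t := by
    filter_upwards [hg, hk] with t hgt hkt
    refine (((((hp t).fun_pow 2).fun_mul hgt.norm_sq).fun_add (hkt.norm_sq.const_mul A)).fun_add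
      (((hq t).fun_pow 2).const_mul B)).congr_deriv ?_
    push_cast
    ring
  have hgx := hg.self_of_nhds
  have hkx := hk.self_of_nhds
  have h2 := ((((((hp x).fun_mul (hq x)).const_mul (-4)).fun_mul hgx.norm_sq).fun_add
    ((((hp x).fun_pow 2).fun_mul (hgx.inner ℝ hg')).const_mul 2)).fun_add
    ((hkx.inner ℝ hk').const_mul (2 * A))).fun_add ((hq x).const_mul (2 * B))
  refine le_trans (le_of_eq ?_) (second_deriv_nonpos_of_isLocalMax h1 h2 hmax)
  simp only [real_inner_self_eq_norm_sq]
  push_cast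
  ring

/-- The real inequality behind Bernstein's gradient estimate. -/
lemma bernstein_ineq {p dx dy r M L P ix iy vx vy iv ux uy iu : ℝ} (hr : 0 < r) (hM : 0 < M)
    (hL : 0 ≤ L) (hp : 0 ≤ p) (hpr : p + dx ^ 2 + dy ^ 2 = r ^ 2) (hP : 0 ≤ P)
    (hix : |ix| ≤ P * vx) (hiy : |iy| ≤ P * vy)
    (hiv : |iv| ≤ P * (L / r ^ 2 * P + 2 * L / r ^ 3 * M)) (hiu : |iu| ≤ L / r ^ 2 * M ^ 2)
    (hPu : P ^ 2 ≤ ux ^ 2 + uy ^ 2)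
    (h : (8 * dx ^ 2 - 4 * p) * P ^ 2 - 16 * p * dx * ix + 2 * p ^ 2 * vx ^ 2
      + ((8 * dy ^ 2 - 4 * p) * P ^ 2 - 16 * p * dy * iy + 2 * p ^ 2 * vy ^ 2)
      + 2 * p ^ 2 * iv + 2 * ((16 + 2 * L) * r ^ 2) * (ux ^ 2 + uy ^ 2 + iu)
      + 4 * ((1 + 17 * L + 2 * L ^ 2) * M ^ 2) ≤ 0) : False := by
  have hcross (d i v : ℝ) (hi : |i| ≤ P * v) :
      -(2 * p ^ 2 * v ^ 2) - 32 * d ^ 2 * P ^ 2 ≤ -(16 * p * d * i) := by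
    have h1 : p * d * i ≤ p * |d| * (P * v) := by
      calc p * d * i ≤ |p * d * i| := le_abs_self _
        _ = p * |d| * |i| := by rw [abs_mul, abs_mul, abs_of_nonneg hp]
        _ ≤ _ := mul_le_mul_of_nonneg_left hi (by positivity)
    have h2 : (p * v - 4 * |d| * P) ^ 2
        = p ^ 2 * v ^ 2 - 8 * (p * |d| * (P * v)) + 16 * d ^ 2 * P ^ 2 := by
      rw [← sq_abs d]
      ring
    linarith [sq_nonneg (p * v - 4 * |d| * P)]
  have hx := hcross dx ix vx hix
  have hy := hcross dy iy vy hiy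
  have hpr' : p ≤ r ^ 2 := by nlinarith [sq_nonneg dx, sq_nonneg dy]
  have hp2 : p ^ 2 ≤ r ^ 4 := by
    calc p ^ 2 ≤ (r ^ 2) ^ 2 := pow_le_pow_left₀ hp hpr' 2
      _ = r ^ 4 := by ring
  have hv : -(4 * L * r ^ 2 * P ^ 2 + 2 * L * M ^ 2) ≤ 2 * p ^ 2 * iv := by
    have h1 : p ^ 2 * |iv| ≤ r ^ 4 * (P * (L / r ^ 2 * P + 2 * L / r ^ 3 * M)) :=
      mul_le_mul hp2 hiv (abs_nonneg _) (by positivity)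
    have h2 : r ^ 4 * (P * (L / r ^ 2 * P + 2 * L / r ^ 3 * M))
        = L * (r * P) ^ 2 + 2 * L * (r * P) * M := by
      field_simp
    have h3 : -(p ^ 2 * |iv|) ≤ p ^ 2 * iv := by
      rw [← mul_neg]
      exact mul_le_mul_of_nonneg_left (neg_abs_le iv) (sq_nonneg p)
    have h4 : 0 ≤ L * (r * P - M) ^ 2 := by positivity
    linarith [h2 ▸ h1]
  have hu : -(2 * (16 + 2 * L) * L * M ^ 2) ≤ 2 * ((16 + 2 * L) * r ^ 2) * iu := by
    have h1 : r ^ 2 * |iu| ≤ L * M ^ 2 := by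
      calc r ^ 2 * |iu| ≤ r ^ 2 * (L / r ^ 2 * M ^ 2) :=
            mul_le_mul_of_nonneg_left hiu (by positivity)
        _ = L * M ^ 2 := by field_simp
    have h2 : -(L * M ^ 2) ≤ r ^ 2 * iu := by
      have h3 := mul_le_mul_of_nonneg_left (neg_abs_le iu) (sq_nonneg r)
      linarith
    have h3 := mul_le_mul_of_nonneg_left h2 (by positivity : 0 ≤ 2 * (16 + 2 * L))
    linarith
  have hG : 2 * ((16 + 2 * L) * r ^ 2) * P ^ 2
      ≤ 2 * ((16 + 2 * L) * r ^ 2) * (ux ^ 2 + uy ^ 2) :=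
    mul_le_mul_of_nonneg_left hPu (by positivity)
  have hd : (dx ^ 2 + dy ^ 2) * P ^ 2 = (r ^ 2 - p) * P ^ 2 := by rw [← hpr]; ring
  have h1 := mul_le_mul_of_nonneg_right hpr' (sq_nonneg P)
  have h2 := mul_nonneg hp (sq_nonneg P)
  have h3 := pow_pos hM 2
  linarith [mul_nonneg hL h3.le, mul_nonneg (sq_nonneg L) h3.le]

/-- Bernstein's gradient estimate: if `u` is bounded by `M` near `z₀`, where near means on the disc
of radius `z₀.im / 2`, then `z₀.im * ‖v z₀‖` is bounded by a multiple of `M`, for `v` dominated by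
the gradient of `u` and solving an equation of the same kind as `u`. -/
lemma bernstein_estimate {u v : ℂ → ℂ} {L M : ℝ}
    (hu : AnalyticOnNhd ℝ u {z : ℂ | 0 < z.im}) (hv : AnalyticOnNhd ℝ v {z : ℂ | 0 < z.im})
    (hL : 0 ≤ L) (hM : 0 < M)
    (hueq : ∀ z : ℂ, 0 < z.im → ‖pdx (pdx u) z + pdy (pdy u) z‖ ≤ L / z.im ^ 2 * ‖u z‖)
    (hveq : ∀ z : ℂ, 0 < z.im → ‖pdx (pdx v) z + pdy (pdy v) z‖
      ≤ L / z.im ^ 2 * ‖v z‖ + 2 * L / z.im ^ 3 * ‖u z‖)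
    (hle : ∀ z : ℂ, 0 < z.im → ‖v z‖ ^ 2 ≤ ‖pdx u z‖ ^ 2 + ‖pdy u z‖ ^ 2)
    {z₀ : ℂ} (hz₀ : 0 < z₀.im)
    (hb : ∀ z : ℂ, z₀.im / 2 ≤ z.im → ‖u z‖ ≤ M) :
    z₀.im * ‖v z₀‖ ≤ 2 * Real.sqrt (17 + 19 * L + 2 * L ^ 2) * M := by
  obtain ⟨r, hr⟩ : ∃ r, r = z₀.im / 2 := ⟨_, rfl⟩
  have hr0 : 0 < r := by rw [hr]; positivity
  set K : ℝ := 16 + 2 * L with hK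
  set B : ℝ := (1 + 17 * L + 2 * L ^ 2) * M ^ 2 with hB
  have hB0 : 0 ≤ B := by positivity
  have hdist (z : ℂ) : ‖z - z₀‖ ^ 2 = (z.re - z₀.re) ^ 2 + (z.im - z₀.im) ^ 2 := by
    rw [Complex.sq_norm, Complex.normSq_apply, Complex.sub_re, Complex.sub_im]
    ring
  set W : ℂ → ℝ := fun z => (r ^ 2 - ‖z - z₀‖ ^ 2) ^ 2 * ‖v z‖ ^ 2 + K * r ^ 2 * ‖u z‖ ^ 2
    + B * ‖z - z₀‖ ^ 2 with hW
  have him : ∀ z ∈ Metric.closedBall z₀ r, r ≤ z.im := by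
    intro z hz
    have h1 : |(z - z₀).im| ≤ r :=
      (Complex.abs_im_le_norm _).trans (by simpa [dist_eq_norm] using hz)
    rw [Complex.sub_im] at h1
    linarith [(abs_le.1 h1).1]
  have hcont : ContinuousOn W (Metric.closedBall z₀ r) := by
    have hsub : Metric.closedBall z₀ r ⊆ {z : ℂ | 0 < z.im} := fun z hz => hr0.trans_le (him z hz)
    have h1 := hu.continuousOn.mono hsub
    have h2 := hv.continuousOn.mono hsub
    fun_prop
  obtain ⟨z₁, hz₁, hmax⟩ := (isCompact_closedBall z₀ r).exists_isMaxOn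
    ⟨z₀, Metric.mem_closedBall_self hr0.le⟩ hcont
  have hz₁r : ‖z₁ - z₀‖ ≤ r := by simpa [dist_eq_norm] using hz₁
  have hW0 : r ^ 4 * ‖v z₀‖ ^ 2 ≤ W z₁ := by
    refine le_trans ?_ (hmax (Metric.mem_closedBall_self hr0.le))
    have h0 : W z₀ = r ^ 4 * ‖v z₀‖ ^ 2 + K * r ^ 2 * ‖u z₀‖ ^ 2 := by
      simp only [hW, sub_self, norm_zero]
      ring
    rw [h0]
    have : 0 ≤ K * r ^ 2 * ‖u z₀‖ ^ 2 := by positivity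
    linarith
  have hz₁r' : r ≤ z₁.im := him z₁ hz₁
  have hz₁im : 0 < z₁.im := hr0.trans_le hz₁r'
  have hu₁ : ‖u z₁‖ ≤ M := hb z₁ (by linarith)
  rcases hz₁r.eq_or_lt with heq | hlt
  · have hW1 : W z₁ ≤ r ^ 2 * ((17 + 19 * L + 2 * L ^ 2) * M ^ 2) := by
      have h1 : W z₁ = K * r ^ 2 * ‖u z₁‖ ^ 2 + B * r ^ 2 := by
        simp only [hW, heq]
        ring
      have h2 : K * r ^ 2 * ‖u z₁‖ ^ 2 ≤ K * r ^ 2 * M ^ 2 := by gcongr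
      rw [h1]
      calc _ ≤ K * r ^ 2 * M ^ 2 + B * r ^ 2 := by linarith
        _ = _ := by rw [hK, hB]; ring
    have h3 : (r * ‖v z₀‖) ^ 2 ≤ (17 + 19 * L + 2 * L ^ 2) * M ^ 2 := by
      have h4 := hW0.trans hW1
      have h5 : r ^ 4 * ‖v z₀‖ ^ 2 = r ^ 2 * (r * ‖v z₀‖) ^ 2 := by ring
      rw [h5] at h4
      exact le_of_mul_le_mul_left h4 (by positivity)
    have h6 := Real.le_sqrt_of_sq_le h3
    rw [Real.sqrt_mul (by positivity), Real.sqrt_sq hM.le] at h6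
    have h7 : z₀.im = 2 * r := by rw [hr]; ring
    rw [h7]
    linarith
  · exfalso
    have hloc : IsLocalMax W z₁ := by
      refine hmax.isLocalMax (mem_nhds_iff.2 ⟨Metric.ball z₀ r, Metric.ball_subset_closedBall,
        Metric.isOpen_ball, ?_⟩)
      simpa [dist_eq_norm] using hlt
    have hloc' : ∀ᶠ z in nhds z₁, W z ≤ W z₁ := hloc
    have hz₁eq : (z₁.re : ℂ) + z₁.im * Complex.I = z₁ := Complex.re_add_im z₁
    have hlx := (hasDerivAt_horizontal z₁.re z₁.im).continuousAt
    have hly := (hasDerivAt_vertical z₁.re z₁.im).continuousAt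
    have hmx : IsLocalMax (fun t : ℝ => W (t + z₁.im * Complex.I)) z₁.re := by
      have h : ∀ᶠ z in nhds ((fun t : ℝ => (t : ℂ) + z₁.im * Complex.I) z₁.re),
          W z ≤ W (z₁.re + z₁.im * Complex.I) := by
        simpa only [hz₁eq] using hloc'
      exact hlx.eventually h
    have hmy : IsLocalMax (fun t : ℝ => W (z₁.re + t * Complex.I)) z₁.im := by
      have h : ∀ᶠ z in nhds ((fun t : ℝ => (z₁.re : ℂ) + t * Complex.I) z₁.im),
          W z ≤ W (z₁.re + z₁.im * Complex.I) := by
        simpa only [hz₁eq] using hloc'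
      exact hly.eventually h
    have hx := bernstein_line (a := r ^ 2 - (z₁.im - z₀.im) ^ 2) (b := z₀.re) (A := K * r ^ 2)
      (B := B) (Filter.Eventually.of_forall fun t => hasDerivAt_pdx hv t hz₁im)
      (hasDerivAt_pdx hv.pdx z₁.re hz₁im)
      (Filter.Eventually.of_forall fun t => hasDerivAt_pdx hu t hz₁im)
      (hasDerivAt_pdx hu.pdx z₁.re hz₁im) (by
        filter_upwards [hmx] with t ht
        simp only [hW, hdist] at ht
        simp at ht
        simp
        ring_nf at ht ⊢
        linarith)
    have hy := bernstein_line (a := r ^ 2 - (z₁.re - z₀.re) ^ 2) (b := z₀.im) (A := K * r ^ 2)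
      (B := B) ((lt_mem_nhds hz₁im).mono fun t ht => hasDerivAt_pdy hv z₁.re ht)
      (hasDerivAt_pdy hv.pdy z₁.re hz₁im)
      ((lt_mem_nhds hz₁im).mono fun t ht => hasDerivAt_pdy hu z₁.re ht)
      (hasDerivAt_pdy hu.pdy z₁.re hz₁im) (by
        filter_upwards [hmy] with t ht
        simp only [hW, hdist] at ht
        simp at ht
        simp
        ring_nf at ht ⊢
        linarith)
    simp only [hz₁eq] at hx hy
    have hsq := hdist z₁
    have hlt2 : ‖z₁ - z₀‖ ^ 2 < r ^ 2 := pow_lt_pow_left₀ hlt (norm_nonneg _) two_ne_zero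
    have hrinv : L / z₁.im ^ 2 ≤ L / r ^ 2 := by gcongr
    have hrinv3 : 2 * L / z₁.im ^ 3 ≤ 2 * L / r ^ 3 := by gcongr
    refine bernstein_ineq (p := r ^ 2 - ‖z₁ - z₀‖ ^ 2) (dx := z₁.re - z₀.re)
      (dy := z₁.im - z₀.im) (P := ‖v z₁‖) (ix := inner ℝ (v z₁) (pdx v z₁))
      (iy := inner ℝ (v z₁) (pdy v z₁)) (vx := ‖pdx v z₁‖) (vy := ‖pdy v z₁‖)
      (iv := inner ℝ (v z₁) (pdx (pdx v) z₁ + pdy (pdy v) z₁))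
      (iu := inner ℝ (u z₁) (pdx (pdx u) z₁ + pdy (pdy u) z₁))
      (ux := ‖pdx u z₁‖) (uy := ‖pdy u z₁‖) hr0 hM hL (by linarith) (by rw [hsq]; ring)
      (norm_nonneg _) (abs_real_inner_le_norm _ _) (abs_real_inner_le_norm _ _)
      ((abs_real_inner_le_norm _ _).trans ?_) ((abs_real_inner_le_norm _ _).trans ?_)
      (hle z₁ hz₁im) ?_
    · refine mul_le_mul_of_nonneg_left ((hveq z₁ hz₁im).trans ?_) (norm_nonneg _)
      gcongr
    · calc ‖u z₁‖ * ‖pdx (pdx u) z₁ + pdy (pdy u) z₁‖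
          ≤ M * (L / r ^ 2 * M) := by
            refine mul_le_mul hu₁ ((hueq z₁ hz₁im).trans ?_) (norm_nonneg _) hM.le
            gcongr
        _ = L / r ^ 2 * M ^ 2 := by ring
    · rw [hsq, inner_add_right, inner_add_right]
      refine le_trans (le_of_eq ?_) (add_nonpos hx hy)
      rw [hK, hB]
      ring

/-- Gradient estimate for eigenfunctions of the hyperbolic Laplacian. -/
lemma exists_gradient_bound (l : ℂ) : ∃ A : ℝ, 0 ≤ A ∧ ∀ (u : ℂ → ℂ) (M : ℝ) (z₀ : ℂ),
    AnalyticOnNhd ℝ u {z : ℂ | 0 < z.im} → (∀ z : ℂ, 0 < z.im → laplace u z = l * u z) →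
    0 < z₀.im → (∀ z : ℂ, z₀.im / 2 ≤ z.im → ‖u z‖ ≤ M) →
    z₀.im * ‖pdx u z₀‖ ≤ A * M ∧ z₀.im * ‖pdy u z₀‖ ≤ A * M := by
  refine ⟨2 * Real.sqrt (17 + 19 * ‖l‖ + 2 * ‖l‖ ^ 2), by positivity, ?_⟩
  intro u M z₀ hu he hz₀ hb
  have hM0 : 0 ≤ M := (norm_nonneg _).trans (hb z₀ (by linarith))
  have hueq (z : ℂ) (hz : 0 < z.im) :
      ‖pdx (pdx u) z + pdy (pdy u) z‖ ≤ ‖l‖ / z.im ^ 2 * ‖u z‖ := by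
    rw [euclidean_eigen he hz]
    simp [abs_of_pos hz]
  have hx (z : ℂ) (hz : 0 < z.im) : ‖pdx (pdx (pdx u)) z + pdy (pdy (pdx u)) z‖
      ≤ ‖l‖ / z.im ^ 2 * ‖pdx u z‖ + 2 * ‖l‖ / z.im ^ 3 * ‖u z‖ := by
    rw [euclidean_eigen_pdx hu he hz]
    simp only [norm_mul, norm_neg, norm_div, norm_pow, Complex.norm_real, Real.norm_eq_abs,
      abs_of_pos hz, le_add_iff_nonneg_right]
    positivity
  have hy (z : ℂ) (hz : 0 < z.im) : ‖pdx (pdx (pdy u)) z + pdy (pdy (pdy u)) z‖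
      ≤ ‖l‖ / z.im ^ 2 * ‖pdy u z‖ + 2 * ‖l‖ / z.im ^ 3 * ‖u z‖ := by
    rw [euclidean_eigen_pdy hu he hz]
    refine (norm_add_le _ _).trans (le_of_eq ?_)
    simp [abs_of_pos hz]
  have key (M' : ℝ) (hM' : M < M') :
      z₀.im * ‖pdx u z₀‖ ≤ 2 * Real.sqrt (17 + 19 * ‖l‖ + 2 * ‖l‖ ^ 2) * M' ∧
      z₀.im * ‖pdy u z₀‖ ≤ 2 * Real.sqrt (17 + 19 * ‖l‖ + 2 * ‖l‖ ^ 2) * M' := by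
    have hM'0 : 0 < M' := hM0.trans_lt hM'
    have hb' : ∀ z : ℂ, z₀.im / 2 ≤ z.im → ‖u z‖ ≤ M' := fun z hz => (hb z hz).trans hM'.le
    exact ⟨bernstein_estimate hu hu.pdx (norm_nonneg l) hM'0 hueq hx
        (fun z _ => le_add_of_nonneg_right (by positivity)) hz₀ hb',
      bernstein_estimate hu hu.pdy (norm_nonneg l) hM'0 hueq hy
        (fun z _ => le_add_of_nonneg_left (by positivity)) hz₀ hb'⟩
  have hcont : Filter.Tendsto
      (fun M' : ℝ => 2 * Real.sqrt (17 + 19 * ‖l‖ + 2 * ‖l‖ ^ 2) * M') (nhdsWithin M (Set.Ioi M))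
      (nhds (2 * Real.sqrt (17 + 19 * ‖l‖ + 2 * ‖l‖ ^ 2) * M)) :=
    ((continuous_const.mul continuous_id).tendsto M).mono_left nhdsWithin_le_nhds
  exact ⟨ge_of_tendsto hcont (Filter.eventually_of_mem self_mem_nhdsWithin fun M' h => (key M' h).1),
    ge_of_tendsto hcont (Filter.eventually_of_mem self_mem_nhdsWithin fun M' h => (key M' h).2)⟩

/-! ### Bounded eigenfunctions with spectral parameter in the left half-plane vanish -/

/-- `y ∂_y u - (1 - s) u`, a factor of the vertical part of `Δ - s (1 - s)`. -/
def verticalFactor (s : ℂ) (u : ℂ → ℂ) (z : ℂ) : ℂ := z.im * pdy u z - (1 - s) * u z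

/-- The density `|y ∂_y u - (1 - s) u|² - |y ∂_x u|²`. -/
def energyDensity (s : ℂ) (u : ℂ → ℂ) (z : ℂ) : ℝ :=
  ‖verticalFactor s u z‖ ^ 2 - (z.im * ‖pdx u z‖) ^ 2

/-- The `x`-derivative of the flux `⟪∂_x u, y ∂_y u - (1 - s) u⟫`. -/
def fluxDeriv (s : ℂ) (u : ℂ → ℂ) (z : ℂ) : ℝ :=
  inner ℝ (pdx u z) (z.im * pdx (pdy u) z - (1 - s) * pdx u z)
    + inner ℝ (pdx (pdx u) z) (verticalFactor s u z)

lemma AnalyticOnNhd.continuousOn_verticalFactor {u : ℂ → ℂ} (s : ℂ)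
    (hu : AnalyticOnNhd ℝ u {z : ℂ | 0 < z.im}) :
    ContinuousOn (verticalFactor s u) {z : ℂ | 0 < z.im} := by
  have h1 := hu.continuousOn
  have h2 := hu.pdy.continuousOn
  unfold verticalFactor
  fun_prop

lemma AnalyticOnNhd.continuousOn_energyDensity {u : ℂ → ℂ} (s : ℂ)
    (hu : AnalyticOnNhd ℝ u {z : ℂ | 0 < z.im}) :
    ContinuousOn (energyDensity s u) {z : ℂ | 0 < z.im} := by
  have h1 := hu.continuousOn_verticalFactor s
  have h2 := hu.pdx.continuousOn
  unfold energyDensity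
  fun_prop

lemma AnalyticOnNhd.continuousOn_fluxDeriv {u : ℂ → ℂ} (s : ℂ)
    (hu : AnalyticOnNhd ℝ u {z : ℂ | 0 < z.im}) :
    ContinuousOn (fluxDeriv s u) {z : ℂ | 0 < z.im} := by
  have h1 := hu.continuousOn_verticalFactor s
  have h2 := hu.pdx.continuousOn
  have h3 := hu.pdx.pdx.continuousOn
  have h4 := hu.pdy.pdx.continuousOn
  unfold fluxDeriv
  fun_prop

lemma hasDerivAt_flux {u : ℂ → ℂ} (s : ℂ) (hu : AnalyticOnNhd ℝ u {z : ℂ | 0 < z.im})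
    (x : ℝ) {y : ℝ} (hy : 0 < y) :
    HasDerivAt (fun t : ℝ => inner ℝ (pdx u (t + y * Complex.I))
      (verticalFactor s u (t + y * Complex.I))) (fluxDeriv s u (x + y * Complex.I)) x := by
  have hb : HasDerivAt (fun t : ℝ => verticalFactor s u (t + y * Complex.I))
      (y * pdx (pdy u) (x + y * Complex.I) - (1 - s) * pdx u (x + y * Complex.I)) x := by
    simpa [verticalFactor] using ((hasDerivAt_pdx hu.pdy x hy).const_mul (y : ℂ)).fun_sub
      ((hasDerivAt_pdx hu x hy).const_mul (1 - s))
  simpa [fluxDeriv] using (hasDerivAt_pdx hu.pdx x hy).inner ℝ hb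

lemma hasDerivAt_energyDensity {u : ℂ → ℂ} {s : ℂ} (hu : AnalyticOnNhd ℝ u {z : ℂ | 0 < z.im})
    (he : ∀ z : ℂ, 0 < z.im → laplace u z = s * (1 - s) * u z) (x : ℝ) {y : ℝ} (hy : 0 < y) :
    HasDerivAt (fun t : ℝ => energyDensity s u (x + t * Complex.I))
      (2 * s.re / y * energyDensity s u (x + y * Complex.I)
        - (4 - 4 * s.re) * y * ‖pdx u (x + y * Complex.I)‖ ^ 2
        - 2 * y * fluxDeriv s u (x + y * Complex.I)) y := by
  have hz : 0 < ((x : ℂ) + y * Complex.I).im := by simpa using hy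
  have him : ((x : ℂ) + y * Complex.I).im = y := by simp
  have hyc : (y : ℂ) ≠ 0 := by exact_mod_cast hy.ne'
  have hid : HasDerivAt (fun t : ℝ => (t : ℂ)) 1 y := by
    simpa using (hasDerivAt_id y).ofReal_comp
  have hb := ((hid.fun_mul (hasDerivAt_pdy hu.pdy x hy)).fun_sub
    ((hasDerivAt_pdy hu x hy).const_mul (1 - s))).norm_sq
  have hh := (hid.fun_mul (hasDerivAt_pdy hu.pdx x hy)).norm_sq
  have hfun : (fun t : ℝ => energyDensity s u (x + t * Complex.I)) = fun t : ℝ =>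
      ‖(t : ℂ) * pdy u (x + t * Complex.I) - (1 - s) * u (x + t * Complex.I)‖ ^ 2
        - ‖(t : ℂ) * pdx u (x + t * Complex.I)‖ ^ 2 := by
    ext t
    simp [energyDensity, verticalFactor, mul_pow]
  rw [hfun]
  refine (hb.fun_sub hh).congr_deriv ?_
  have hyy : pdy (pdy u) (x + y * Complex.I) = -(s * (1 - s) / (y : ℂ) ^ 2) * u (x + y * Complex.I)
      - pdx (pdx u) (x + y * Complex.I) := by
    have h := euclidean_eigen he hz
    rw [him] at h
    linear_combination h
  have hsub : 1 * pdy u (x + y * Complex.I) + (y : ℂ) * pdy (pdy u) (x + y * Complex.I)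
      - (1 - s) * pdy u (x + y * Complex.I)
      = ((1 / y : ℝ) : ℂ) * (s * ((y : ℂ) * pdy u (x + y * Complex.I)
        - (1 - s) * u (x + y * Complex.I)) - (y : ℂ) ^ 2 * pdx (pdx u) (x + y * Complex.I)) := by
    rw [hyy]
    push_cast
    field_simp
    ring
  rw [hsub, ← pdx_pdy_comm hu hz]
  simp only [energyDensity, fluxDeriv, verticalFactor, him]
  obtain ⟨b, hbdef⟩ : ∃ b, b = (y : ℂ) * pdy u (x + y * Complex.I)
    - (1 - s) * u (x + y * Complex.I) := ⟨_, rfl⟩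
  rw [← hbdef]
  simp only [mul_pow, Complex.sq_norm, Complex.normSq_apply, Complex.inner, Complex.mul_re,
    Complex.mul_im, Complex.sub_re, Complex.sub_im, Complex.add_re, Complex.add_im,
    Complex.conj_re, Complex.conj_im, Complex.ofReal_re, Complex.ofReal_im, Complex.one_re,
    Complex.one_im, ← Complex.ofReal_pow]
  field_simp
  ring

lemma hasDerivAt_rpow_mul_energyDensity {u : ℂ → ℂ} {s : ℂ}
    (hu : AnalyticOnNhd ℝ u {z : ℂ | 0 < z.im})
    (he : ∀ z : ℂ, 0 < z.im → laplace u z = s * (1 - s) * u z) (x : ℝ) {y : ℝ} (hy : 0 < y) :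
    HasDerivAt (fun t : ℝ => t ^ (-2 * s.re) * energyDensity s u (x + t * Complex.I))
      (-(y ^ (-2 * s.re) * ((4 - 4 * s.re) * y * ‖pdx u (x + y * Complex.I)‖ ^ 2
        + 2 * y * fluxDeriv s u (x + y * Complex.I)))) y := by
  refine ((Real.hasDerivAt_rpow_const (p := -2 * s.re) (Or.inl hy.ne')).fun_mul
    (hasDerivAt_energyDensity hu he x hy)).congr_deriv ?_
  rw [Real.rpow_sub_one hy.ne']
  field_simp
  ring

/-- Differentiation in `y` under an integral over a horizontal segment. -/
lemma hasDerivAt_integral_horizontal {F F' : ℂ → ℝ} (N : ℝ)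
    (hF : ContinuousOn F {z : ℂ | 0 < z.im}) (hF' : ContinuousOn F' {z : ℂ | 0 < z.im})
    (hd : ∀ x y : ℝ, 0 < y →
      HasDerivAt (fun t : ℝ => F (x + t * Complex.I)) (F' (x + y * Complex.I)) y)
    {y : ℝ} (hy : 0 < y) :
    HasDerivAt (fun t : ℝ => ∫ x in (0 : ℝ)..N, F (x + t * Complex.I))
      (∫ x in (0 : ℝ)..N, F' (x + y * Complex.I)) y := by
  have hline {G : ℂ → ℝ} (hG : ContinuousOn G {z : ℂ | 0 < z.im}) {t : ℝ} (ht : 0 < t) :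
      Continuous fun x : ℝ => G (x + t * Complex.I) :=
    hG.comp_continuous (by fun_prop) fun x => by simpa using ht
  have hcomp : IsCompact ((fun p : ℝ × ℝ => (p.1 : ℂ) + p.2 * Complex.I) ''
      (Set.uIcc 0 N ×ˢ Set.Icc (y / 2) (2 * y))) :=
    (isCompact_uIcc.prod isCompact_Icc).image (by fun_prop)
  obtain ⟨C, hC⟩ := hcomp.exists_bound_of_continuousOn (hF'.mono (by
    rintro _ ⟨⟨a, b⟩, ⟨_, hb⟩, rfl⟩
    have : 0 < b := lt_of_lt_of_le (by positivity) hb.1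
    simpa using this))
  refine (intervalIntegral.hasDerivAt_integral_of_dominated_loc_of_deriv_le (𝕜 := ℝ)
    (F := fun t x : ℝ => F (x + t * Complex.I)) (F' := fun t x : ℝ => F' (x + t * Complex.I))
    (bound := fun _ : ℝ => C) (Icc_mem_nhds (by linarith : y / 2 < y) (by linarith : y < 2 * y))
    ?_ ?_ ?_ ?_ ?_ ?_).2
  · filter_upwards [lt_mem_nhds hy] with t ht using (hline hF ht).aestronglyMeasurable
  · exact (hline hF hy).intervalIntegrable _ _
  · exact (hline hF' hy).aestronglyMeasurable
  · refine Filter.Eventually.of_forall fun x hx t ht => hC _ ⟨(x, t), ⟨?_, ht⟩, rfl⟩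
    exact Set.uIoc_subset_uIcc hx
  · exact intervalIntegrable_const
  · refine Filter.Eventually.of_forall fun x _ t ht => hd x t ?_
    exact lt_of_lt_of_le (by positivity) ht.1

lemma pdx_add_period {f : ℂ → ℂ} {N : ℝ} (hper : ∀ z : ℂ, 0 < z.im → f (z + N) = f z) {z : ℂ}
    (hz : 0 < z.im) : pdx f (z + N) = pdx f z := by
  simp only [pdx, Complex.add_re, Complex.add_im, Complex.ofReal_re, Complex.ofReal_im, add_zero]
  rw [← deriv_comp_add_const]
  congr 1
  ext t
  rw [← hper (t + z.im * Complex.I) (by simpa using hz)]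
  congr 1
  push_cast
  ring

lemma pdy_add_period {f : ℂ → ℂ} {N : ℝ} (hper : ∀ z : ℂ, 0 < z.im → f (z + N) = f z) {z : ℂ}
    (hz : 0 < z.im) : pdy f (z + N) = pdy f z := by
  simp only [pdy, Complex.add_re, Complex.add_im, Complex.ofReal_re, Complex.ofReal_im, add_zero]
  refine Filter.EventuallyEq.deriv_eq ?_
  filter_upwards [lt_mem_nhds hz] with t ht
  rw [← hper (z.re + t * Complex.I) (by simpa using ht)]
  congr 1
  push_cast
  ring

lemma exists_energyDensity_bound (s : ℂ) : ∃ B : ℝ, 0 ≤ B ∧ ∀ (u : ℂ → ℂ) (M : ℝ) (z₀ : ℂ),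
    AnalyticOnNhd ℝ u {z : ℂ | 0 < z.im} →
    (∀ z : ℂ, 0 < z.im → laplace u z = s * (1 - s) * u z) → 0 < z₀.im →
    (∀ z : ℂ, z₀.im / 2 ≤ z.im → ‖u z‖ ≤ M) → |energyDensity s u z₀| ≤ B * M ^ 2 := by
  obtain ⟨A, hA, h⟩ := exists_gradient_bound (s * (1 - s))
  refine ⟨(A + ‖1 - s‖) ^ 2 + A ^ 2, by positivity, fun u M z₀ hu he hz hM => ?_⟩
  obtain ⟨hx, hy⟩ := h u M z₀ hu he hz hM
  have hu0 := hM z₀ (by linarith)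
  have hb : ‖verticalFactor s u z₀‖ ≤ (A + ‖1 - s‖) * M := by
    calc ‖verticalFactor s u z₀‖ ≤ ‖(z₀.im : ℂ) * pdy u z₀‖ + ‖(1 - s) * u z₀‖ := norm_sub_le _ _
      _ = z₀.im * ‖pdy u z₀‖ + ‖1 - s‖ * ‖u z₀‖ := by
        rw [norm_mul, norm_mul, Complex.norm_real, Real.norm_of_nonneg hz.le]
      _ ≤ A * M + ‖1 - s‖ * M := by gcongr
      _ = (A + ‖1 - s‖) * M := by ring
  have h1 := pow_le_pow_left₀ (norm_nonneg _) hb 2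
  have h2 := pow_le_pow_left₀ (by positivity) hx 2
  rw [energyDensity, abs_le]
  constructor <;> nlinarith [sq_nonneg (‖verticalFactor s u z₀‖), sq_nonneg (z₀.im * ‖pdx u z₀‖)]

lemma eq_zero_of_integral_eq_zero {g : ℝ → ℝ} {N : ℝ} (hN : 0 < N) (hg : Continuous g)
    (h0 : ∀ x, 0 ≤ g x) (hi : ∫ x in (0 : ℝ)..N, g x = 0) : ∀ x ∈ Set.Icc 0 N, g x = 0 := by
  intro x hx
  by_contra hne
  have := intervalIntegral.integral_lt_integral_of_continuousOn_of_le_of_exists_lt hN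
    (f := fun _ => 0) continuousOn_const hg.continuousOn (fun x _ => h0 x)
    ⟨x, hx, (h0 x).lt_of_ne' hne⟩
  simp [hi] at this

lemma eq_zero_of_antitoneOn_of_tendsto {f : ℝ → ℝ} (hf : AntitoneOn f (Set.Ioi 0))
    (h0 : Filter.Tendsto f (nhdsWithin 0 (Set.Ioi 0)) (nhds 0))
    (hinf : Filter.Tendsto f Filter.atTop (nhds 0)) {y : ℝ} (hy : 0 < y) : f y = 0 := by
  refine le_antisymm (ge_of_tendsto h0 ?_) (le_of_tendsto hinf ?_)
  · filter_upwards [Ioo_mem_nhdsGT hy] with t ht using hf ht.1 hy ht.2.le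
  · filter_upwards [Filter.eventually_ge_atTop y] with t ht using hf hy (hy.trans_le ht) ht

/-- A bounded periodic eigenfunction with small enough growth at the cusp and spectral parameter
in the open left half-plane has vanishing `verticalFactor`. -/
lemma verticalFactor_eq_zero_of_re_neg {s : ℂ} (hs : s.re < 0) {u : ℂ → ℂ}
    (hu : AnalyticOnNhd ℝ u {z : ℂ | 0 < z.im})
    (he : ∀ z : ℂ, 0 < z.im → laplace u z = s * (1 - s) * u z) {N : ℝ} (hN : 0 < N)
    (hper : ∀ z : ℂ, 0 < z.im → u (z + N) = u z) {M : ℝ} (hM : ∀ z : ℂ, 0 < z.im → ‖u z‖ ≤ M)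
    (hdec : ∃ K T : ℝ, ∀ z : ℂ, 0 < z.im → T ≤ z.im → ‖u z‖ ≤ K * z.im ^ (s.re - 1))
    {x y : ℝ} (hx : x ∈ Set.Icc 0 N) (hy : 0 < y) :
    verticalFactor s u (x + y * Complex.I) = 0 := by
  set Φ : ℝ → ℝ := fun t => ∫ x in (0 : ℝ)..N, t ^ (-2 * s.re) * energyDensity s u (x + t * Complex.I)
    with hΦ
  have hline {E : Type} [TopologicalSpace E] {G : ℂ → E} (hG : ContinuousOn G {z : ℂ | 0 < z.im})
      {t : ℝ} (ht : 0 < t) : Continuous fun x : ℝ => G (x + t * Complex.I) :=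
    hG.comp_continuous (by fun_prop) fun x => by simpa using ht
  have hrpow (p : ℝ) : ContinuousOn (fun z : ℂ => z.im ^ p) {z : ℂ | 0 < z.im} :=
    Complex.continuous_im.continuousOn.rpow_const fun z hz => Or.inl (ne_of_gt hz)
  have hcx := hu.pdx.continuousOn
  have hcf := hu.continuousOn_fluxDeriv s
  have hcv := hu.continuousOn_verticalFactor s
  have hce := hu.continuousOn_energyDensity s
  have hflux {t : ℝ} (ht : 0 < t) : ∫ x in (0 : ℝ)..N, fluxDeriv s u (x + t * Complex.I) = 0 := by
    rw [intervalIntegral.integral_eq_sub_of_hasDerivAt (fun x _ => hasDerivAt_flux s hu x ht)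
      ((hline hcf ht).intervalIntegrable _ _)]
    have hz : 0 < ((0 : ℝ) + t * Complex.I : ℂ).im := by simpa using ht
    have hadd : ((N : ℂ) + t * Complex.I) = ((0 : ℝ) + t * Complex.I : ℂ) + N := by
      push_cast
      ring
    rw [hadd, verticalFactor, pdx_add_period hper hz, pdy_add_period hper hz, hper _ hz]
    simp [verticalFactor]
  have hderiv {t : ℝ} (ht : 0 < t) : HasDerivAt Φ (-(t ^ (-2 * s.re) * ((4 - 4 * s.re) * t)
      * ∫ x in (0 : ℝ)..N, ‖pdx u (x + t * Complex.I)‖ ^ 2)) t := by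
    have h := hasDerivAt_integral_horizontal (F := fun z => z.im ^ (-2 * s.re) * energyDensity s u z)
      (F' := fun z => -(z.im ^ (-2 * s.re) * ((4 - 4 * s.re) * z.im * ‖pdx u z‖ ^ 2
        + 2 * z.im * fluxDeriv s u z))) N ((hrpow _).mul hce)
      (by have := hrpow (-2 * s.re); fun_prop)
      (fun x t ht => by simpa using hasDerivAt_rpow_mul_energyDensity hu he x ht) ht
    simp only [Complex.add_im, Complex.ofReal_im, Complex.mul_im, Complex.I_im, Complex.ofReal_re,
      Complex.I_re, mul_zero, mul_one, zero_add, add_zero] at h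
    refine h.congr_deriv ?_
    have hi1 : IntervalIntegrable (fun x : ℝ => (4 - 4 * s.re) * t
        * ‖pdx u (x + t * Complex.I)‖ ^ 2) volume 0 N :=
      (continuous_const.mul ((hline hcx ht).norm.pow 2)).intervalIntegrable _ _
    have hi2 : IntervalIntegrable (fun x : ℝ => 2 * t * fluxDeriv s u (x + t * Complex.I))
        volume 0 N :=
      (continuous_const.mul (hline hcf ht)).intervalIntegrable _ _
    rw [intervalIntegral.integral_neg, intervalIntegral.integral_const_mul,
      intervalIntegral.integral_add hi1 hi2, intervalIntegral.integral_const_mul,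
      intervalIntegral.integral_const_mul, hflux ht]
    ring
  have hnn (t : ℝ) : 0 ≤ ∫ x in (0 : ℝ)..N, ‖pdx u (x + t * Complex.I)‖ ^ 2 :=
    intervalIntegral.integral_nonneg hN.le fun x _ => by positivity
  have hanti : AntitoneOn Φ (Set.Ioi 0) := by
    refine antitoneOn_of_deriv_nonpos (convex_Ioi 0)
      (fun t ht => (hderiv ht).continuousAt.continuousWithinAt)
      (fun t ht => ?_) (fun t ht => ?_) <;> rw [interior_Ioi] at ht
    · exact (hderiv ht).differentiableAt.differentiableWithinAt
    · rw [(hderiv ht).deriv, neg_nonpos]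
      have ht' : 0 < t := ht
      have := hnn t
      have : 0 < 4 - 4 * s.re := by linarith
      positivity
  obtain ⟨B, hB, hbound⟩ := exists_energyDensity_bound s
  have hΦle {t m : ℝ} (ht : 0 < t) (hm : ∀ z : ℂ, t / 2 ≤ z.im → ‖u z‖ ≤ m) :
      ‖Φ t‖ ≤ t ^ (-2 * s.re) * (B * m ^ 2) * N := by
    have h := intervalIntegral.norm_integral_le_of_norm_le_const (a := 0) (b := N)
      (f := fun x : ℝ => t ^ (-2 * s.re) * energyDensity s u (x + t * Complex.I))
      (C := t ^ (-2 * s.re) * (B * m ^ 2)) fun x _ => by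
        rw [norm_mul, Real.norm_of_nonneg (by positivity : 0 ≤ t ^ (-2 * s.re)), Real.norm_eq_abs]
        gcongr
        exact hbound u m _ hu he (by simpa using ht) (by simpa using hm)
    rwa [sub_zero, abs_of_pos hN] at h
  have hzero : Filter.Tendsto Φ (nhdsWithin 0 (Set.Ioi 0)) (nhds 0) := by
    have h : Filter.Tendsto (fun t : ℝ => t ^ (-2 * s.re) * (B * M ^ 2) * N)
        (nhdsWithin 0 (Set.Ioi 0)) (nhds 0) := by
      have hc : Continuous fun t : ℝ => t ^ (-2 * s.re) * (B * M ^ 2) * N :=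
        ((Real.continuous_rpow_const (by linarith)).mul_const _).mul_const _
      have := (hc.tendsto 0).mono_left (nhdsWithin_le_nhds (s := Set.Ioi 0))
      rwa [Real.zero_rpow (by linarith), zero_mul, zero_mul] at this
    refine squeeze_zero_norm' ?_ h
    filter_upwards [self_mem_nhdsWithin] with t ht
    have ht' : 0 < t := ht
    exact hΦle ht fun z hz => hM z (by linarith)
  have hinf : Filter.Tendsto Φ Filter.atTop (nhds 0) := by
    obtain ⟨K, T, hK⟩ := hdec
    have h : Filter.Tendsto (fun t : ℝ => 2 ^ (-2 * s.re) * (B * |K| ^ 2) * N * (t / 2) ^ (-2 : ℝ))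
        Filter.atTop (nhds 0) := by
      have := ((tendsto_rpow_neg_atTop (two_pos)).comp
        (Filter.tendsto_id.atTop_div_const (two_pos (α := ℝ)))).const_mul
          (2 ^ (-2 * s.re) * (B * |K| ^ 2) * N)
      simpa using this
    refine squeeze_zero_norm' ?_ h
    filter_upwards [Filter.eventually_ge_atTop (2 * T), Filter.eventually_gt_atTop 0] with t htT ht
    have hm : ∀ z : ℂ, t / 2 ≤ z.im → ‖u z‖ ≤ |K| * (t / 2) ^ (s.re - 1) := by
      intro z hz
      refine (hK z (by linarith) (by linarith)).trans ?_
      have h1 : z.im ^ (s.re - 1) ≤ (t / 2) ^ (s.re - 1) :=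
        Real.rpow_le_rpow_of_nonpos (by linarith) hz (by linarith)
      have h0 : 0 ≤ z.im ^ (s.re - 1) := Real.rpow_nonneg (by linarith) _
      exact mul_le_mul (le_abs_self K) h1 h0 (abs_nonneg K)
    refine (hΦle ht hm).trans_eq ?_
    have ht2 : 0 < t / 2 := by linarith
    have e1 : t ^ (-2 * s.re) = 2 ^ (-2 * s.re) * (t / 2) ^ (-2 * s.re) := by
      rw [← Real.mul_rpow (by norm_num) ht2.le]
      congr 1
      ring
    have e2 : (t / 2) ^ (-2 * s.re) * ((t / 2) ^ (s.re - 1)) ^ 2 = (t / 2) ^ (-2 : ℝ) := by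
      rw [← Real.rpow_mul_natCast ht2.le, ← Real.rpow_add ht2]
      congr 1
      push_cast
      ring
    rw [e1, ← e2]
    ring
  have hΦ0 {t : ℝ} (ht : 0 < t) : Φ t = 0 := eq_zero_of_antitoneOn_of_tendsto hanti hzero hinf ht
  have hpx : ∀ x ∈ Set.Icc 0 N, ‖pdx u (x + y * Complex.I)‖ ^ 2 = 0 := by
    refine eq_zero_of_integral_eq_zero hN ((hline hcx hy).norm.pow 2) (fun x => by positivity) ?_
    have hev : Φ =ᶠ[nhds y] fun _ => 0 := by
      filter_upwards [lt_mem_nhds hy] with t ht using hΦ0 ht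
    have h := (hderiv hy).unique ((hasDerivAt_const y (0 : ℝ)).congr_of_eventuallyEq hev)
    rw [neg_eq_zero, mul_eq_zero] at h
    refine h.resolve_left (ne_of_gt ?_)
    have : 0 < 4 - 4 * s.re := by linarith
    positivity
  have hvf : ∀ x ∈ Set.Icc 0 N, ‖verticalFactor s u (x + y * Complex.I)‖ ^ 2 = 0 := by
    refine eq_zero_of_integral_eq_zero hN
      ((hline hcv hy).norm.pow 2) (fun x => by positivity) ?_
    have h := hΦ0 hy
    simp only [hΦ, intervalIntegral.integral_const_mul, mul_eq_zero,
      (Real.rpow_pos_of_pos hy _).ne', false_or] at h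
    refine Eq.trans (intervalIntegral.integral_congr fun x hx => ?_) h
    rw [Set.uIcc_of_le hN.le] at hx
    simp [energyDensity, mul_pow, hpx x hx]
  exact norm_eq_zero.mp (pow_eq_zero_iff two_ne_zero |>.mp (hvf x hx))

/-- A bounded periodic eigenfunction with small enough growth at the cusp and spectral parameter
in the open left half-plane vanishes. -/
lemma eq_zero_of_re_neg {s : ℂ} (hs : s.re < 0) {u : ℂ → ℂ}
    (hu : AnalyticOnNhd ℝ u {z : ℂ | 0 < z.im})
    (he : ∀ z : ℂ, 0 < z.im → laplace u z = s * (1 - s) * u z) {N : ℝ} (hN : 0 < N)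
    (hper : ∀ z : ℂ, 0 < z.im → u (z + N) = u z) {M : ℝ} (hM : ∀ z : ℂ, 0 < z.im → ‖u z‖ ≤ M)
    (hdec : ∃ K T : ℝ, ∀ z : ℂ, 0 < z.im → T ≤ z.im → ‖u z‖ ≤ K * z.im ^ (s.re - 1))
    {z : ℂ} (hz : 0 < z.im) : u z = 0 := by
  have hstrip : ∀ x ∈ Set.Icc 0 N, ∀ y : ℝ, 0 < y → u (x + y * Complex.I) = 0 := by
    intro x hx y hy
    set h : ℝ → ℝ := fun t => t ^ (-(2 * (1 - s.re))) * ‖u (x + t * Complex.I)‖ ^ 2 with hdef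
    have hderiv : ∀ t ∈ Set.Ioi (0 : ℝ), HasDerivAt h 0 t := by
      intro t ht
      have ht' : 0 < t := ht
      have htc : (t : ℂ) ≠ 0 := by exact_mod_cast ht'.ne'
      have hv := verticalFactor_eq_zero_of_re_neg hs hu he hN hper hM hdec hx ht'
      have hp : pdy u (x + t * Complex.I) = ((1 / t : ℝ) : ℂ) * ((1 - s) * u (x + t * Complex.I)) := by
        simp only [verticalFactor, Complex.add_im, Complex.ofReal_im, Complex.mul_im,
          Complex.I_im, Complex.ofReal_re, Complex.I_re, mul_zero, mul_one, zero_add,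
          add_zero] at hv
        push_cast
        field_simp
        linear_combination hv
      refine ((Real.hasDerivAt_rpow_const (p := -(2 * (1 - s.re))) (Or.inl ht'.ne')).fun_mul
        (hasDerivAt_pdy hu x ht').norm_sq).congr_deriv ?_
      rw [Real.rpow_sub_one ht'.ne', hp]
      simp only [Complex.sq_norm, Complex.normSq_apply, Complex.inner, Complex.mul_re,
        Complex.mul_im, Complex.sub_re, Complex.sub_im, Complex.conj_re, Complex.conj_im,
        Complex.ofReal_re, Complex.ofReal_im, Complex.one_re, Complex.one_im]
      field_simp
      ring
    have hconst : ∀ t : ℝ, 0 < t → h t = h y := fun t ht =>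
      isOpen_Ioi.is_const_of_deriv_eq_zero isPreconnected_Ioi
        (fun r hr => (hderiv r hr).differentiableAt.differentiableWithinAt)
        (fun r hr => (hderiv r hr).deriv) ht hy
    have hlim : Filter.Tendsto h Filter.atTop (nhds 0) := by
      have h1 := (tendsto_rpow_neg_atTop (by linarith : 0 < 2 * (1 - s.re))).mul_const (M ^ 2)
      rw [zero_mul] at h1
      refine squeeze_zero' ?_ ?_ h1 <;> filter_upwards [Filter.eventually_gt_atTop 0] with t ht
      · positivity
      · have := hM (x + t * Complex.I) (by simpa using ht)
        simp only [hdef]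
        gcongr
    have h0 : h y = 0 := tendsto_nhds_unique (tendsto_const_nhds.congr' (by
      filter_upwards [Filter.eventually_gt_atTop 0] with t ht using (hconst t ht).symm)) hlim
    simpa [hdef, (Real.rpow_pos_of_pos hy _).ne'] using h0
  have hP : Function.Periodic (fun x : ℝ => u (x + z.im * Complex.I)) N := fun x => by
    beta_reduce
    rw [← hper (x + z.im * Complex.I) (by simpa using hz)]
    congr 1
    push_cast
    ring
  obtain ⟨x, hx, hxz⟩ := hP.exists_mem_Ico₀ hN z.re
  simp only [Complex.re_add_im] at hxz
  rw [hxz]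
  exact hstrip x ⟨hx.1, hx.2.le⟩ z.im hz

/-! ### Vector valued cusp forms: periodicity, boundedness and decay -/

lemma rho_translation (n : ℕ) {μ : ℕ} (α : Fin μ → SL2) {g : SL2}
    (hg : (g : Matrix (Fin 2) (Fin 2) ℤ) = !![1, (n : ℤ); 0, 1]) : rho n α g = rho n α 1 := by
  ext i j
  simp only [rho]
  congr 1
  simp only [Gam0, Set.mem_ofPred_eq, eq_iff_iff, mul_one]
  have key : ((α i * g * (α j)⁻¹ : SL2) : Matrix (Fin 2) (Fin 2) ℤ) 1 0
      = ((α i * (α j)⁻¹ : SL2) : Matrix (Fin 2) (Fin 2) ℤ) 1 0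
        - n * (α i 1 0 * α j 1 0) := by
    simp only [Matrix.SpecialLinearGroup.coe_mul, Matrix.SpecialLinearGroup.coe_inv,
      Matrix.adjugate_fin_two, Matrix.mul_apply, Fin.sum_univ_two, hg]
    simp
    ring
  rw [key]
  exact dvd_sub_left (Dvd.intro _ rfl)

lemma norm_rho_le_one (n : ℕ) {μ : ℕ} (α : Fin μ → SL2) (g : SL2) (i j : Fin μ) :
    ‖rho n α g i j‖ ≤ 1 := by
  unfold rho
  split_ifs <;> simp

lemma moeb_eq_smul (g : SL2) (τ : UpperHalfPlane) :
    moeb (g : Matrix (Fin 2) (Fin 2) ℤ) τ = ((g • τ : UpperHalfPlane) : ℂ) := by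
  rw [UpperHalfPlane.coe_specialLinearGroup_apply]
  simp [moeb]

namespace IsVVCuspForm

variable {n μ : ℕ} {α : Fin μ → SL2} {s : ℂ} {U : ℂ → Fin μ → ℂ}

lemma add_level (hU : IsVVCuspForm n α s U) {z : ℂ} (hz : 0 < z.im) (j : Fin μ) :
    U (z + n) j = U z j := by
  have hdet : (!![1, (n : ℤ); 0, 1] : Matrix (Fin 2) (Fin 2) ℤ).det = 1 := by
    simp [Matrix.det_fin_two_of]
  have h1 := hU.equivar ⟨!![1, (n : ℤ); 0, 1], hdet⟩ z hz j
  have h2 := hU.equivar 1 z hz j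
  rw [rho_translation n α (g := ⟨!![1, (n : ℤ); 0, 1], hdet⟩) rfl, ← h2] at h1
  simpa [moeb] using h1

lemma norm_le_sum (hU : IsVVCuspForm n α s U) (g : SL2) {z : ℂ} (hz : 0 < z.im) (j : Fin μ) :
    ‖U (moeb g z) j‖ ≤ ∑ k, ‖U z k‖ := by
  rw [hU.equivar g z hz j]
  refine (norm_sum_le _ _).trans (Finset.sum_le_sum fun k _ => ?_)
  rw [norm_mul]
  exact mul_le_of_le_one_left (norm_nonneg _) (norm_rho_le_one n α g j k)

lemma bounded_on_strip (hU : IsVVCuspForm n α s U) (j : Fin μ) :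
    ∃ M : ℝ, ∀ z : ℂ, 1 / 2 ≤ z.im → |z.re| ≤ 1 / 2 → ‖U z j‖ ≤ M := by
  obtain ⟨K, T, hK⟩ := hU.decay j 0
  have hcomp : IsCompact (Set.Icc (-(1 / 2) : ℝ) (1 / 2) ×ℂ Set.Icc (1 / 2 : ℝ) T) :=
    isCompact_Icc.reProdIm isCompact_Icc
  obtain ⟨M, hM⟩ := hcomp.exists_bound_of_continuousOn ((hU.analytic j).continuousOn.mono
    fun z hz => lt_of_lt_of_le (by norm_num) hz.2.1)
  refine ⟨max K M, fun z hz hre => ?_⟩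
  rcases le_total T z.im with hT | hT
  · have := hK z (by linarith) hT
    rw [Real.rpow_zero, mul_one] at this
    exact this.trans (le_max_left _ _)
  · exact (hM z ⟨abs_le.mp hre, hz, hT⟩).trans (le_max_right _ _)

lemma bounded (hU : IsVVCuspForm n α s U) :
    ∃ M : ℝ, ∀ j, ∀ z : ℂ, 0 < z.im → ‖U z j‖ ≤ M := by
  choose M hM using hU.bounded_on_strip
  refine ⟨∑ k, M k, fun j z hz => ?_⟩
  obtain ⟨g, hg⟩ := ModularGroup.exists_smul_mem_fd ⟨z, hz⟩
  set w : UpperHalfPlane := g • ⟨z, hz⟩ with hw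
  have hzw : z = moeb (g⁻¹ : SL2) w := by
    rw [moeb_eq_smul, hw, inv_smul_smul]
  rw [hzw]
  refine (hU.norm_le_sum g⁻¹ w.im_pos j).trans (Finset.sum_le_sum fun k _ => hM k w ?_ hg.2)
  have h3 := ModularGroup.three_le_four_mul_im_sq_of_mem_fd hg
  have h0 := w.im_pos
  change 1 / 2 ≤ w.im
  nlinarith

/-- Decay of the components and of their `x`-derivatives along the imaginary axis at `i∞`. -/
lemma isBigO_atTop (hU : IsVVCuspForm n α s U) (j : Fin μ) (C : ℝ) :
    (fun y : ℝ => U (y * Complex.I) j) =O[Filter.atTop] (fun y : ℝ => y ^ C) ∧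
    (fun y : ℝ => pdx (fun w => U w j) (y * Complex.I)) =O[Filter.atTop] (fun y : ℝ => y ^ C) := by
  obtain ⟨A, hA, hgrad⟩ := exists_gradient_bound (s * (1 - s))
  obtain ⟨K, T, hK⟩ := hU.decay j (-|C|)
  have hbd : ∀ᶠ y : ℝ in Filter.atTop, 0 < y ∧ y ^ (-|C|) ≤ y ^ C ∧
      ∀ z : ℂ, y / 2 ≤ z.im → ‖U z j‖ ≤ |K| * (2 ^ |C| * y ^ (-|C|)) := by
    filter_upwards [Filter.eventually_ge_atTop (2 * T), Filter.eventually_ge_atTop 1] with y hT h1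
    refine ⟨by linarith, Real.rpow_le_rpow_of_exponent_le h1 (neg_abs_le C), fun z hz => ?_⟩
    refine (hK z (by linarith) (by linarith)).trans ?_
    have h2 : z.im ^ (-|C|) ≤ 2 ^ |C| * y ^ (-|C|) := by
      refine (Real.rpow_le_rpow_of_nonpos (by linarith) hz (by simp)).trans_eq ?_
      rw [Real.div_rpow (by linarith) (by norm_num), Real.rpow_neg zero_le_two, div_inv_eq_mul,
        mul_comm]
    exact mul_le_mul (le_abs_self K) h2 (Real.rpow_nonneg (by linarith) _) (abs_nonneg K)
  constructor
  · refine Asymptotics.IsBigO.of_bound (|K| * 2 ^ |C|) ?_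
    filter_upwards [hbd] with y ⟨hy, hC, h⟩
    rw [Real.norm_of_nonneg (by positivity), mul_assoc]
    refine (h (y * Complex.I) (by simpa using half_le_self hy.le)).trans ?_
    gcongr
  · refine Asymptotics.IsBigO.of_bound (A * (|K| * 2 ^ |C|)) ?_
    filter_upwards [hbd, Filter.eventually_ge_atTop 1] with y ⟨hy, hC, h⟩ h1
    rw [Real.norm_of_nonneg (by positivity), mul_assoc, mul_assoc]
    have h2 := (hgrad (fun w => U w j) _ (y * Complex.I) (hU.analytic j) (hU.eigen j)
      (by simpa using hy) (by simpa using h)).1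
    simp only [Complex.mul_im, Complex.ofReal_re, Complex.I_im, mul_one, Complex.ofReal_im,
      Complex.I_re, mul_zero, add_zero] at h2
    refine (le_mul_of_one_le_left (norm_nonneg _) h1).trans (h2.trans ?_)
    gcongr

lemma apply_neg_inv (hU : IsVVCuspForm n α s U) {z : ℂ} (hz : 0 < z.im) (j : Fin μ) :
    U z j = ∑ k, rho n α ModularGroup.S j k * U (-z⁻¹) k := by
  have hz0 : z ≠ 0 := by
    rintro rfl
    simp at hz
  have him : 0 < (-z⁻¹).im := by
    have := Complex.normSq_pos.mpr hz0
    rw [Complex.neg_im, Complex.inv_im]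
    have : 0 < z.im / Complex.normSq z := by positivity
    rw [neg_div, neg_neg]
    exact this
  rw [← hU.equivar ModularGroup.S _ him j]
  congr 1
  simp [moeb, ModularGroup.S]

lemma pdx_apply_neg_inv (hU : IsVVCuspForm n α s U) {y : ℝ} (hy : 0 < y) (j : Fin μ) :
    pdx (fun w => U w j) (y * Complex.I) = ∑ k, rho n α ModularGroup.S j k *
      (-((y⁻¹ ^ 2 : ℝ) : ℂ) * pdx (fun w => U w k) ((y⁻¹ : ℝ) * Complex.I)) := by
  have hyc : (y : ℂ) ≠ 0 := by exact_mod_cast hy.ne'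
  have hpt : -((0 : ℝ) + y * Complex.I : ℂ)⁻¹ = ((y⁻¹ : ℝ) : ℂ) * Complex.I := by
    simp [mul_comm]
  have hinv : HasDerivAt (fun t : ℝ => -((t : ℂ) + y * Complex.I)⁻¹) (-((y⁻¹ ^ 2 : ℝ) : ℂ)) 0 := by
    have h := ((hasDerivAt_horizontal 0 y).fun_inv (by simp [hyc])).fun_neg
    refine h.congr_deriv ?_
    push_cast
    field_simp
    simp [mul_pow]
  have hk (k : Fin μ) : HasDerivAt (fun t : ℝ => U (-((t : ℂ) + y * Complex.I)⁻¹) k)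
      (-((y⁻¹ ^ 2 : ℝ) : ℂ) * pdx (fun w => U w k) ((y⁻¹ : ℝ) * Complex.I)) 0 := by
    have hd : DifferentiableAt ℝ (fun w => U w k) (((y⁻¹ : ℝ) : ℂ) * Complex.I) :=
      differentiableAt_of_analyticOnNhd (hU.analytic k) (by simpa using hy)
    have h := HasFDerivAt.comp_hasDerivAt (0 : ℝ) (by rw [hpt]; exact hd.hasFDerivAt) hinv
    refine h.congr_deriv ?_
    have hlin (L : ℂ →L[ℝ] ℂ) (r : ℝ) : L (r : ℂ) = r * L 1 := by
      rw [← Complex.real_smul, ← map_smul, Complex.real_smul, mul_one]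
    rw [pdx_eq_fderiv hd, ← Complex.ofReal_neg, hlin]
  have hsum := HasDerivAt.fun_sum (u := Finset.univ) fun k _ =>
    (hk k).const_mul (rho n α ModularGroup.S j k)
  rw [← hsum.deriv]
  simp only [pdx, Complex.mul_im, Complex.mul_re, Complex.ofReal_re, Complex.I_im, mul_one,
    Complex.ofReal_im, Complex.I_re, mul_zero, add_zero, sub_zero]
  congr 1
  ext t
  exact hU.apply_neg_inv (by simpa using hy) j

/-- Decay of the components and of their `x`-derivatives along the imaginary axis at `0`. -/
lemma isBigO_nhdsGT_zero (hU : IsVVCuspForm n α s U) (j : Fin μ) (C : ℝ) :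
    (fun y : ℝ => U (y * Complex.I) j) =O[nhdsWithin 0 (Set.Ioi 0)] (fun y : ℝ => y ^ C) ∧
    (fun y : ℝ => pdx (fun w => U w j) (y * Complex.I))
      =O[nhdsWithin 0 (Set.Ioi 0)] (fun y : ℝ => y ^ C) := by
  have hpow (D : ℝ) : (fun y : ℝ => y⁻¹ ^ (-D)) =ᶠ[nhdsWithin 0 (Set.Ioi 0)] fun y : ℝ => y ^ D := by
    filter_upwards [self_mem_nhdsWithin] with y hy
    rw [Real.inv_rpow (le_of_lt hy), Real.rpow_neg (le_of_lt hy), inv_inv]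
  constructor
  · have h : (fun y : ℝ => ∑ k, rho n α ModularGroup.S j k * U ((y⁻¹ : ℝ) * Complex.I) k)
        =O[nhdsWithin 0 (Set.Ioi 0)] (fun y : ℝ => y ^ C) :=
      Asymptotics.IsBigO.fun_sum fun k _ => ((((hU.isBigO_atTop k (-C)).1).comp_tendsto
        tendsto_inv_nhdsGT_zero).trans_eventuallyEq (hpow C)).const_mul_left _
    refine h.congr' ?_ Filter.EventuallyEq.rfl
    filter_upwards [self_mem_nhdsWithin] with y hy
    rw [hU.apply_neg_inv (by simpa using hy) j]
    simp [mul_comm]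
  · have h : (fun y : ℝ => ∑ k, rho n α ModularGroup.S j k *
        (-((y⁻¹ ^ 2 : ℝ) : ℂ) * pdx (fun w => U w k) ((y⁻¹ : ℝ) * Complex.I)))
        =O[nhdsWithin 0 (Set.Ioi 0)] (fun y : ℝ => y ^ C) := by
      refine Asymptotics.IsBigO.fun_sum fun k _ => Asymptotics.IsBigO.const_mul_left ?_ _
      have h1 := (((hU.isBigO_atTop k (-(C + 2))).2).comp_tendsto
        tendsto_inv_nhdsGT_zero).trans_eventuallyEq (hpow (C + 2))
      have h2 : (fun y : ℝ => -((y⁻¹ ^ 2 : ℝ) : ℂ)) =O[nhdsWithin 0 (Set.Ioi 0)]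
          (fun y : ℝ => y⁻¹ ^ 2) :=
        Asymptotics.IsBigO.of_norm_left (by simpa using Asymptotics.isBigO_refl _ _)
      refine (h2.mul h1).trans_eventuallyEq ?_
      filter_upwards [self_mem_nhdsWithin] with y hy
      have hy' : 0 < y := hy
      rw [Real.rpow_add hy', Real.rpow_two]
      field_simp
    refine h.congr' ?_ Filter.EventuallyEq.rfl
    filter_upwards [self_mem_nhdsWithin] with y hy using (hU.pdx_apply_neg_inv hy j).symm

end IsVVCuspForm

/-! ### Estimates for the integral transform -/

lemma exists_bound_mul_rpow {f : ℝ → ℂ} (hf : ContinuousOn f (Set.Ioi 0)) {C : ℝ}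
    (hinf : f =O[Filter.atTop] fun y : ℝ => y ^ C)
    (hzero : f =O[nhdsWithin 0 (Set.Ioi 0)] fun y : ℝ => y ^ C) :
    ∃ K : ℝ, ∀ y : ℝ, 0 < y → ‖f y‖ ≤ K * y ^ C := by
  obtain ⟨K₁, h₁⟩ := hinf.bound
  obtain ⟨K₀, h₀⟩ := hzero.bound
  obtain ⟨b, hb⟩ := Filter.eventually_atTop.mp h₁
  obtain ⟨a, ha, hab⟩ := mem_nhdsGT_iff_exists_Ioo_subset.mp h₀
  have ha' : 0 < a := ha
  have hpos : ∀ y ∈ Set.Icc a b, 0 < y := fun y hy => ha'.trans_le hy.1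
  obtain ⟨K₂, h₂⟩ := (isCompact_Icc (a := a) (b := b)).exists_bound_of_continuousOn
    (f := fun y => ‖f y‖ / y ^ C)
    ((hf.mono hpos).norm.div (continuousOn_id.rpow_const fun y hy => Or.inl (hpos y hy).ne')
      fun y hy => (Real.rpow_pos_of_pos (hpos y hy) C).ne')
  refine ⟨max K₀ (max K₁ K₂), fun y hy => ?_⟩
  have hyC := Real.rpow_pos_of_pos hy C
  rw [← div_le_iff₀ hyC]
  rcases lt_or_ge y a with hya | hya
  · refine le_max_of_le_left ((div_le_iff₀ hyC).mpr ?_)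
    simpa [abs_of_pos hyC] using hab ⟨hy, hya⟩
  · refine le_max_of_le_right ?_
    rcases le_or_gt b y with hyb | hyb
    · refine le_max_of_le_left ((div_le_iff₀ hyC).mpr ?_)
      simpa [abs_of_pos hyC] using hb y hyb
    · exact le_max_of_le_right ((le_abs_self _).trans (h₂ y ⟨hya, hyb.le⟩))

lemma exists_rpow_mul_norm_le {f : ℝ → ℂ} (hf : ContinuousOn f (Set.Ioi 0))
    (hinf : ∀ C : ℝ, f =O[Filter.atTop] fun y : ℝ => y ^ C)
    (hzero : ∀ C : ℝ, f =O[nhdsWithin 0 (Set.Ioi 0)] fun y : ℝ => y ^ C) (c : ℝ) :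
    ∃ K : ℝ, ∀ y : ℝ, 0 < y → y ^ c * ‖f y‖ ≤ K * (1 + y ^ 2)⁻¹ := by
  obtain ⟨K₁, h₁⟩ := exists_bound_mul_rpow hf (hinf (-c)) (hzero (-c))
  obtain ⟨K₂, h₂⟩ := exists_bound_mul_rpow hf (hinf (-(c + 2))) (hzero (-(c + 2)))
  refine ⟨K₁ + K₂, fun y hy => ?_⟩
  have hc := Real.rpow_pos_of_pos hy c
  have e₁ := h₁ y hy
  have e₂ := h₂ y hy
  rw [Real.rpow_neg hy.le, ← div_eq_mul_inv, le_div_iff₀ (by positivity)] at e₁ e₂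
  rw [Real.rpow_add hy, Real.rpow_two] at e₂
  rw [← div_eq_mul_inv, le_div_iff₀ (by positivity)]
  linarith

lemma Rfun_mul_I (ζ y : ℝ) : Rfun ζ (y * Complex.I) = y / (ζ ^ 2 + y ^ 2) := by
  simp [Rfun]

lemma norm_Rpow_mul_I (s : ℂ) (ζ : ℝ) {y : ℝ} (hy : 0 < y) :
    ‖Rpow s ζ (y * Complex.I)‖ = Rfun ζ (y * Complex.I) ^ s.re := by
  have : 0 < Rfun ζ (y * Complex.I) := by
    rw [Rfun_mul_I]
    positivity
  exact Complex.norm_cpow_eq_rpow_re_of_pos this s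

lemma norm_pdx_Rpow_mul_I_le (s : ℂ) {ζ y : ℝ} (hζ : 0 < ζ) (hy : 0 < y) :
    ‖pdx (Rpow s ζ) (y * Complex.I)‖ ≤ ‖s‖ * y⁻¹ * Rfun ζ (y * Complex.I) ^ s.re := by
  have hR : 0 < Rfun ζ (y * Complex.I) := by
    rw [Rfun_mul_I]
    positivity
  have hden : (0 - ζ) ^ 2 + y ^ 2 ≠ 0 := by positivity
  have hd : HasDerivAt (fun x : ℝ => y / ((x - ζ) ^ 2 + y ^ 2))
      (Rfun ζ (y * Complex.I) * (2 * ζ / (ζ ^ 2 + y ^ 2))) 0 := by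
    have h := (((((hasDerivAt_id (0 : ℝ)).sub_const ζ).fun_pow 2).add_const (y ^ 2)).fun_inv
      hden).const_mul y
    refine h.congr_deriv ?_
    rw [Rfun_mul_I]
    have : ζ ^ 2 + y ^ 2 ≠ 0 := by positivity
    simp
    field_simp
  have hR' : y / ((0 - ζ) ^ 2 + y ^ 2) = Rfun ζ (y * Complex.I) := by
    rw [Rfun_mul_I]
    ring
  have hpow : HasDerivAt (fun x : ℝ => ((y / ((x - ζ) ^ 2 + y ^ 2) : ℝ) : ℂ) ^ s)
      (s * (Rfun ζ (y * Complex.I) : ℂ) ^ (s - 1)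
        * ((Rfun ζ (y * Complex.I) * (2 * ζ / (ζ ^ 2 + y ^ 2)) : ℝ) : ℂ)) 0 := by
    have hc : HasDerivAt (fun w : ℂ => w ^ s) (s * (Rfun ζ (y * Complex.I) : ℂ) ^ (s - 1))
        (Rfun ζ (y * Complex.I) : ℂ) := by
      simpa using (hasDerivAt_id (Rfun ζ (y * Complex.I) : ℂ)).cpow_const (c := s)
        (Complex.ofReal_mem_slitPlane.mpr hR)
    exact HasDerivAt.comp_of_eq (0 : ℝ) hc hd.ofReal_comp (by rw [hR'])
  have heq : pdx (Rpow s ζ) (y * Complex.I) = s * (Rfun ζ (y * Complex.I) : ℂ) ^ (s - 1)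
        * ((Rfun ζ (y * Complex.I) * (2 * ζ / (ζ ^ 2 + y ^ 2)) : ℝ) : ℂ) := by
    rw [← hpow.deriv]
    simp [pdx, Rpow, Rfun]
  have hle : 2 * ζ / (ζ ^ 2 + y ^ 2) ≤ y⁻¹ := by
    rw [← one_div, div_le_div_iff₀ (by positivity) hy]
    nlinarith [sq_nonneg (ζ - y)]
  rw [heq, norm_mul, norm_mul, Complex.norm_cpow_eq_rpow_re_of_pos hR, Complex.norm_real,
    Real.norm_of_nonneg (by positivity), Complex.sub_re, Complex.one_re, Real.rpow_sub_one hR.ne']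
  calc ‖s‖ * (Rfun ζ (y * Complex.I) ^ s.re / Rfun ζ (y * Complex.I))
        * (Rfun ζ (y * Complex.I) * (2 * ζ / (ζ ^ 2 + y ^ 2)))
      = ‖s‖ * (2 * ζ / (ζ ^ 2 + y ^ 2)) * Rfun ζ (y * Complex.I) ^ s.re := by
        field_simp
    _ ≤ ‖s‖ * y⁻¹ * Rfun ζ (y * Complex.I) ^ s.re := by gcongr

lemma IsVVCuspForm.exists_norm_Ptrans_le {n μ : ℕ} {α : Fin μ → SL2} {s : ℂ}
    {U : ℂ → Fin μ → ℂ} (hU : IsVVCuspForm n α s U) (i : Fin μ) (c : ℝ) :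
    ∃ K : ℝ, ∀ ζ D : ℝ, 0 < ζ → 0 ≤ D →
      (∀ y : ℝ, 0 < y → Rfun ζ (y * Complex.I) ^ s.re ≤ D * y ^ c) →
      ‖Ptrans s (fun w => U w i) ζ‖ ≤ K * D := by
  have hcont {f : ℂ → ℂ} (hf : ContinuousOn f {z : ℂ | 0 < z.im}) :
      ContinuousOn (fun y : ℝ => f (y * Complex.I)) (Set.Ioi 0) :=
    hf.comp (by fun_prop) fun y hy => by simpa using hy
  obtain ⟨K₁, h₁⟩ := exists_rpow_mul_norm_le (hcont (hU.analytic i).continuousOn)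
    (fun C => (hU.isBigO_atTop i C).1) (fun C => (hU.isBigO_nhdsGT_zero i C).1) (c - 1)
  obtain ⟨K₂, h₂⟩ := exists_rpow_mul_norm_le (hcont (hU.analytic i).pdx.continuousOn)
    (fun C => (hU.isBigO_atTop i C).2) (fun C => (hU.isBigO_nhdsGT_zero i C).2) c
  refine ⟨(‖s‖ * K₁ + K₂) * ∫ y in Set.Ioi (0 : ℝ), (1 + y ^ 2)⁻¹, fun ζ D hζ hD hR => ?_⟩
  rw [mul_right_comm, ← integral_const_mul]
  refine norm_integral_le_of_norm_le (integrable_inv_one_add_sq.integrableOn.const_mul _)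
    ((ae_restrict_iff' measurableSet_Ioi).mpr (Filter.Eventually.of_forall fun y hy => ?_))
  have hy' : 0 < y := hy
  set a := ‖U (y * Complex.I) i‖
  set b := ‖pdx (fun w => U w i) (y * Complex.I)‖
  have e₁ := h₁ y hy'
  rw [Real.rpow_sub_one hy'.ne'] at e₁
  calc _ ≤ a * ‖pdx (Rpow s ζ) (y * Complex.I)‖ + ‖Rpow s ζ (y * Complex.I)‖ * b := by
        refine (norm_sub_le _ _).trans_eq ?_
        rw [norm_mul, norm_mul]
    _ ≤ a * (‖s‖ * y⁻¹ * (D * y ^ c)) + D * y ^ c * b := by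
        rw [norm_Rpow_mul_I s ζ hy']
        have := (norm_pdx_Rpow_mul_I_le s hζ hy').trans
          (mul_le_mul_of_nonneg_left (hR y hy') (by positivity))
        have := hR y hy'
        gcongr
    _ = D * (‖s‖ * (y ^ c / y * a) + y ^ c * b) := by ring
    _ ≤ D * (‖s‖ * (K₁ * (1 + y ^ 2)⁻¹) + K₂ * (1 + y ^ 2)⁻¹) := by
        have := h₂ y hy'
        gcongr
    _ = (‖s‖ * K₁ + K₂) * D * (1 + y ^ 2)⁻¹ := by ring

lemma IsVVCuspForm.eq_zero_of_re_neg {n μ : ℕ} {α : Fin μ → SL2} {s : ℂ}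
    {U : ℂ → Fin μ → ℂ} (hn : 1 ≤ n) (hU : IsVVCuspForm n α s U) (hs : s.re < 0) (i : Fin μ)
    {z : ℂ} (hz : 0 < z.im) : U z i = 0 := by
  obtain ⟨M, hM⟩ := hU.bounded
  have hN : (0 : ℝ) < n := by exact_mod_cast hn
  exact _root_.eq_zero_of_re_neg hs (hU.analytic i) (hU.eigen i) hN
    (fun w hw => by simpa using hU.add_level hw i) (hM i) (hU.decay i _) hz

lemma Ptrans_eq_zero {s : ℂ} {v : ℂ → ℂ} (hv : ∀ z : ℂ, 0 < z.im → v z = 0) (ζ : ℝ) :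
    Ptrans s v ζ = 0 := by
  refine setIntegral_eq_zero_of_forall_eq_zero fun y hy => ?_
  have him : 0 < ((y : ℂ) * Complex.I).im := by simpa using hy
  rw [hv _ him, pdx_congr (g := fun _ => 0) hv him]
  simp [pdx]
/-- growth of the components of `Pu⃗`:
`(Pu⃗)_i(ζ) = O(ζ^{max(0,-2Re s)})` as `ζ ↓ 0` and
`(Pu⃗)_i(ζ) = O(ζ^{min(0,-2Re s)})` as `ζ → ∞`. -/
theorem stmt17 (n : ℕ) (hn : 1 ≤ n) (s : ℂ) (μ : ℕ) (α : Fin μ → SL2)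
    (hrep : IsCosetReps n α) (U : ℂ → Fin μ → ℂ) (hU : IsVVCuspForm n α s U) :
    ∀ i : Fin μ,
      (∃ K ε : ℝ, 0 < ε ∧ ∀ ζ : ℝ, 0 < ζ → ζ < ε →
        ‖Ptrans s (fun w => U w i) ζ‖ ≤ K * ζ ^ (max 0 (-2 * s.re))) ∧
      (∃ K T : ℝ, ∀ ζ : ℝ, T ≤ ζ → 0 < ζ →
        ‖Ptrans s (fun w => U w i) ζ‖ ≤ K * ζ ^ (min 0 (-2 * s.re))) := by
  intro i
  rcases lt_or_ge s.re 0 with hs | hs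
  · have h0 (ζ : ℝ) : Ptrans s (fun w => U w i) ζ = 0 :=
      Ptrans_eq_zero (fun z hz => hU.eq_zero_of_re_neg hn hs i hz) ζ
    exact ⟨⟨0, 1, one_pos, fun ζ _ _ => by simp [h0]⟩, ⟨0, 0, fun ζ _ _ => by simp [h0]⟩⟩
  · have hmax : max 0 (-2 * s.re) = 0 := max_eq_left (by linarith)
    have hmin : min 0 (-2 * s.re) = -2 * s.re := min_eq_right (by linarith)
    rw [hmax, hmin]
    constructor
    · obtain ⟨K, hK⟩ := hU.exists_norm_Ptrans_le i (-s.re)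
      refine ⟨K, 1, one_pos, fun ζ hζ _ => ?_⟩
      rw [Real.rpow_zero]
      refine hK ζ 1 hζ zero_le_one fun y hy => ?_
      rw [one_mul, Rfun_mul_I, Real.rpow_neg hy.le, ← Real.inv_rpow hy.le]
      refine Real.rpow_le_rpow (by positivity) ?_ hs
      rw [← one_div, div_le_div_iff₀ (by positivity) hy]
      nlinarith [sq_nonneg ζ]
    · obtain ⟨K, hK⟩ := hU.exists_norm_Ptrans_le i s.re
      refine ⟨K, 0, fun ζ _ hζ => hK ζ _ hζ (by positivity) fun y hy => ?_⟩
      have hζ2 : ζ ^ (-2 * s.re) = (ζ ^ 2)⁻¹ ^ s.re := by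
        rw [neg_mul, Real.rpow_neg hζ.le, Real.rpow_mul hζ.le, Real.rpow_two,
          Real.inv_rpow (by positivity)]
      rw [Rfun_mul_I, hζ2, ← Real.mul_rpow (by positivity) hy.le]
      refine Real.rpow_le_rpow (by positivity) ?_ hs
      rw [← div_eq_inv_mul]
      exact div_le_div_of_nonneg_left hy.le (by positivity) (by nlinarith [sq_nonneg y])

end
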